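/- arXiv:1808.00453 — 7 statements merged into one kernel-verified Lean document; each statement's English description precedes it below -/
import Mathlib

section
/- For every integer k ≥ 5 there exists a constant c > 0 (depending only on k) such that for every integer n ≥ k the following holds: there exists a k-uniform hypergraph H on a vertex set of size at least 2^(c·n^(k-4)) such that every (k+1)-element subset of the vertices induces exactly 0, 2, or 4 edges of H, and H contains no independent set of size n. Equivalently, g_k(n) > 2^(c·n^(k-4)). -/
open Finset

/-- The number of colourings avoiding a fixed pattern on each of several disjoint blocks. -/
theorem card_avoiding_le {I C E : Type*} [Fintype I] [Fintype C] [DecidableEq I] [DecidableEq C]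
    [DecidableEq E] [Nonempty C] (π : I → C) (T : E → Finset I) (m : ℕ) (s : Finset E)
    (hm : ∀ e ∈ s, #(T e) ≤ m) (hd : (s : Set E).PairwiseDisjoint T) :
    (#{ω : I → C | ∀ e ∈ s, ∃ t ∈ T e, ω t ≠ π t} : ℝ) ≤
      (1 - 1 / (Fintype.card C : ℝ) ^ m) ^ #s * Fintype.card (I → C) := by
  have hK : (1 : ℝ) ≤ Fintype.card C := by exact_mod_cast Fintype.card_pos
  have hq : 1 / (Fintype.card C : ℝ) ^ m ≤ 1 :=
    (div_le_one (by positivity)).2 (one_le_pow₀ hK)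
  induction s using Finset.induction_on with
  | empty => simp
  | insert a s ha ih =>
    rw [coe_insert, Set.pairwiseDisjoint_insert_of_notMem (by simpa using ha)] at hd
    have ih := ih (fun e he => hm e (mem_insert_of_mem he)) hd.1
    set A : Finset (I → C) := {ω | ∀ e ∈ s, ∃ t ∈ T e, ω t ≠ π t} with hA
    set B : Finset (I → C) := {ω ∈ A | ∀ t ∈ T a, ω t = π t} with hB
    have hsub : ({ω : I → C | ∀ e ∈ insert a s, ∃ t ∈ T e, ω t ≠ π t} : Finset _) = A \ B := by
      ext ω
      simp only [hA, hB, mem_filter, mem_univ, true_and, mem_sdiff, forall_mem_insert]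
      constructor
      · rintro ⟨⟨t, ht, h1⟩, h2⟩
        exact ⟨h2, fun h => h1 (h.2 t ht)⟩
      · rintro ⟨h2, h3⟩
        refine ⟨?_, h2⟩
        by_contra! h
        exact h3 ⟨h2, h⟩
    have hAB : #A ≤ Fintype.card C ^ m * #B := by
      refine card_le_mul_card_image_of_maps_to
        (f := fun ω t => if t ∈ T a then π t else ω t) ?_ _ ?_
      · intro ω hω
        simp only [hA, hB, mem_filter, mem_univ, true_and] at hω ⊢
        refine ⟨fun e he => ?_, fun t ht => by simp [ht]⟩
        obtain ⟨t, ht, h⟩ := hω e he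
        have : t ∉ T a := fun h' => disjoint_left.1 (hd.2 e he) h' ht
        exact ⟨t, ht, by simpa [this] using h⟩
      · intro ω₀ _
        calc _ ≤ #(univ : Finset (T a → C)) := by
              refine card_le_card_of_injOn (fun ω t => ω t) (by simp) ?_
              intro ω hω ω' hω' h
              simp only [coe_filter, Set.mem_ofPred_eq] at hω hω'
              funext t
              by_cases ht : t ∈ T a
              · exact congrFun h ⟨t, ht⟩
              · have := congrFun (hω.2.trans hω'.2.symm) t
                simpa [ht] using this
          _ = Fintype.card C ^ #(T a) := by simp
          _ ≤ _ := Nat.pow_le_pow_right Fintype.card_pos (hm a (mem_insert_self _ _))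
    have hBA : #(A \ B) + #B = #A := card_sdiff_add_card_eq_card (filter_subset _ _)
    have hAB' : (#A : ℝ) ≤ (Fintype.card C : ℝ) ^ m * #B := by exact_mod_cast hAB
    have hBA' : (#(A \ B) : ℝ) + #B = #A := by exact_mod_cast hBA
    rw [hsub, card_insert_of_notMem ha, pow_succ']
    have h1 : 1 / (Fintype.card C : ℝ) ^ m * #A ≤ #B := by
      rw [one_div, inv_mul_le_iff₀ (by positivity)]
      exact hAB'
    calc (#(A \ B) : ℝ) ≤ (1 - 1 / (Fintype.card C : ℝ) ^ m) * #A := by linarith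
      _ ≤ _ := by
        rw [mul_assoc]
        exact mul_le_mul_of_nonneg_left ih (by linarith)

/-- Reed-Solomon codes give `p ^ d` transversals, no two of which share `d` elements. -/
theorem exists_transversal_family {ι V : Type*} [Fintype ι] [DecidableEq V] (p d : ℕ)
    [Fact p.Prime] (hp : Fintype.card ι ≤ p) (s : ι × ZMod p ↪ V) :
    ∃ c : (Fin d → ZMod p) → ι → ZMod p, ∀ f g, ∀ Y : Finset V, d ≤ #Y →
      Y ⊆ univ.image (fun i => s (i, c f i)) → Y ⊆ univ.image (fun i => s (i, c g i)) → f = g := by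
  classical
  obtain ⟨x⟩ : Nonempty (ι ↪ ZMod p) :=
    Function.Embedding.nonempty_of_card_le (by simpa [ZMod.card] using hp)
  let P (f : Fin d → ZMod p) := (Polynomial.degreeLTEquiv (ZMod p) d).symm f
  refine ⟨fun f i => (P f).1.eval (x i), fun f g Y hY hf hg => ?_⟩
  let Z : Finset ι := {i | s (i, (P f).1.eval (x i)) ∈ Y}
  have hZ : Y ⊆ Z.image (fun i => s (i, (P f).1.eval (x i))) := by
    intro y hy
    obtain ⟨i, -, hi⟩ := mem_image.1 (hf hy)
    exact mem_image.2 ⟨i, by simpa [Z, hi] using hy, hi⟩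
  have hZd : d ≤ #(Z.map x) := by
    rw [card_map]
    exact hY.trans ((card_le_card hZ).trans card_image_le)
  have hlt (f : Fin d → ZMod p) : (P f).1.degree < (#(Z.map x) : ℕ) :=
    (Polynomial.mem_degreeLT.1 (P f).2).trans_le (by exact_mod_cast hZd)
  have : (P f).1 = (P g).1 := by
    refine Polynomial.eq_of_degrees_lt_of_eval_finset_eq _ (hlt f) (hlt g) ?_
    intro z hz
    obtain ⟨i, hi, rfl⟩ := mem_map.1 hz
    obtain ⟨j, -, hj⟩ := mem_image.1 (hg (mem_filter.1 hi).2)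
    have := s.injective hj
    simp only [Prod.mk.injEq] at this
    obtain ⟨rfl, h⟩ := this
    exact h.symm
  exact (Polynomial.degreeLTEquiv (ZMod p) d).symm.injective (Subtype.ext this)

/-- `X` carries a bijective labelling compatible with the partial labellings `ω Y` of all
its `d`-element subsets `Y`. -/
def IsLabelled {V : Type*} (d : ℕ) (ω : Finset V × V → Option (Fin (d + 2))) (X : Finset V) :
    Prop :=
  ∃ l : V → Fin (d + 2), Set.InjOn l X ∧
    ∀ Y ⊆ X, #Y = d → ∀ y ∈ Y, ω (Y, y) = some (l y)

/-- The pairs whose removal from `W` leaves a labelled set. -/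
def labelGraph {V : Type*} [DecidableEq V] (d : ℕ) (ω : Finset V × V → Option (Fin (d + 2)))
    (W : Finset V) : SimpleGraph V where
  Adj a b := a ≠ b ∧ a ∈ W ∧ b ∈ W ∧ IsLabelled d ω (W \ {a, b})
  symm := ⟨fun a b h => ⟨h.1.symm, h.2.2.1, h.2.1, by rw [pair_comm]; exact h.2.2.2⟩⟩
  loopless := ⟨fun a h => h.1 rfl⟩

section
variable {V : Type*} [DecidableEq V] {d : ℕ} {ω : Finset V × V → Option (Fin (d + 2))}
  {W : Finset V}

theorem label_eq_of_mem {X X' : Finset V} {l l' : V → Fin (d + 2)} (hd : 1 ≤ d)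
    (hl : ∀ Y ⊆ X, #Y = d → ∀ y ∈ Y, ω (Y, y) = some (l y))
    (hl' : ∀ Y ⊆ X', #Y = d → ∀ y ∈ Y, ω (Y, y) = some (l' y))
    (hc : d ≤ #(X ∩ X')) {y : V} (hy : y ∈ X) (hy' : y ∈ X') : l y = l' y := by
  obtain ⟨Y, h1, h2, h3⟩ := exists_subsuperset_card_eq (s := {y}) (t := X ∩ X') (n := d)
    (by simp [hy, hy']) (by simpa using hd) hc
  have hyY : y ∈ Y := h1 (mem_singleton_self y)
  have := (hl Y (h2.trans inter_subset_left) h3 y hyY).symm.trans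
    (hl' Y (h2.trans inter_subset_right) h3 y hyY)
  exact Option.some.inj this

theorem le_card_sdiff_inter_sdiff (hW : #W = d + 4) (a b a' b' : V) :
    d ≤ #((W \ {a, b}) ∩ (W \ {a', b'})) := by
  have h : W \ ({a, b} ∪ {a', b'}) ⊆ (W \ {a, b}) ∩ (W \ {a', b'}) := by
    rw [sdiff_union_distrib]
  have h1 := card_le_card h
  have h2 := le_card_sdiff ({a, b} ∪ {a', b'}) W
  have h3 := card_union_le ({a, b} : Finset V) {a', b'}
  have h4 := card_le_two (a := a) (b := b)
  have h5 := card_le_two (a := a') (b := b')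
  omega

theorem image_label_eq_univ (hW : #W = d + 4) {a b : V} (hab : a ≠ b) (ha : a ∈ W) (hb : b ∈ W)
    {l : V → Fin (d + 2)} (hl : Set.InjOn l ↑(W \ {a, b})) : (W \ {a, b}).image l = univ := by
  apply eq_univ_of_card
  rw [card_image_of_injOn hl, card_sdiff_of_subset (by simp [insert_subset_iff, ha, hb]),
    card_pair hab, hW]
  simp

/-- A vertex of the label graph has at most two neighbours. -/
theorem labelGraph_not_adj_three (hd : 1 ≤ d) (hW : #W = d + 4) {a b c e : V}
    (hb : (labelGraph d ω W).Adj a b) (hc : (labelGraph d ω W).Adj a c)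
    (he : (labelGraph d ω W).Adj a e) (hbc : b ≠ c) (hbe : b ≠ e) (hce : c ≠ e) : False := by
  obtain ⟨hab, haW, hbW, l, hl, hl'⟩ := hb
  obtain ⟨hac, -, hcW, m, hm, hm'⟩ := hc
  obtain ⟨hae, -, heW, r, hr, hr'⟩ := he
  have hml {y} (h1) (h2) := label_eq_of_mem (y := y) hd hm' hl'
    (le_card_sdiff_inter_sdiff hW _ _ _ _) h1 h2
  have hrl {y} (h1) (h2) := label_eq_of_mem (y := y) hd hr' hl'
    (le_card_sdiff_inter_sdiff hW _ _ _ _) h1 h2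
  have hrm {y} (h1) (h2) := label_eq_of_mem (y := y) hd hr' hm'
    (le_card_sdiff_inter_sdiff hW _ _ _ _) h1 h2
  have hb1 : b ∈ W \ {a, c} := by simp [hbW, hab.symm, hbc]
  have key : l c = m b := by
    have := image_label_eq_univ hW hab haW hbW hl
    obtain ⟨z, hz, hzb⟩ := mem_image.1 (this ▸ mem_univ (m b))
    by_cases hzc : z = c
    · rw [← hzc, hzb]
    · simp only [mem_sdiff, mem_insert, mem_singleton, not_or] at hz
      have hz' : z ∈ W \ {a, c} := by simp [hz, hzc]
      have : m z = m b := (hml hz' (by simp [hz])).trans hzb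
      exact absurd (hm hz' hb1 this) hz.2.2
  have h1 : r c = l c := hrl (by simp [hcW, hac.symm, hce]) (by simp [hcW, hac.symm, hbc.symm])
  have h2 : r b = m b := hrm (by simp [hbW, hab.symm, hbe]) hb1
  exact hbc (hr (by simp [hbW, hab.symm, hbe]) (by simp [hcW, hac.symm, hce])
    (h2.trans (key.symm.trans h1.symm)))

/-- If the label graph has two disjoint edges, every edge lies inside their union. -/
theorem labelGraph_adj_mem_of_disjoint (hd : 1 ≤ d) (hW : #W = d + 4) {a b a' b' x y : V}
    (h : (labelGraph d ω W).Adj a b) (h' : (labelGraph d ω W).Adj a' b')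
    (hx : (labelGraph d ω W).Adj x y) (haa : a ≠ a') (hab' : a ≠ b') (hba' : b ≠ a')
    (hbb : b ≠ b') : x = a ∨ x = b ∨ x = a' ∨ x = b' := by
  obtain ⟨hab, haW, hbW, l, hl, hl'⟩ := h
  obtain ⟨hab'', haW', hbW', m, hm, hm'⟩ := h'
  obtain ⟨hxy, hxW, hyW, r, hr, hr'⟩ := hx
  by_contra! hne
  obtain ⟨hxa, hxb, hxa', hxb'⟩ := hne
  have hml {y} (h1) (h2) := label_eq_of_mem (y := y) hd hm' hl'
    (le_card_sdiff_inter_sdiff hW _ _ _ _) h1 h2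
  have hrl {y} (h1) (h2) := label_eq_of_mem (y := y) hd hr' hl'
    (le_card_sdiff_inter_sdiff hW _ _ _ _) h1 h2
  have hrm {y} (h1) (h2) := label_eq_of_mem (y := y) hd hr' hm'
    (le_card_sdiff_inter_sdiff hW _ _ _ _) h1 h2
  have ham : a ∈ W \ {a', b'} := by simp [haW, haa, hab']
  have hbm : b ∈ W \ {a', b'} := by simp [hbW, hba', hbb]
  have key : ∀ t ∈ W \ {a', b'}, (t = a ∨ t = b) → m t = l a' ∨ m t = l b' := by
    intro t ht htab
    have := image_label_eq_univ hW hab haW hbW hl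
    obtain ⟨z, hz, hzt⟩ := mem_image.1 (this ▸ mem_univ (m t))
    by_cases hza : z = a'
    · left; rw [← hza, hzt]
    by_cases hzb : z = b'
    · right; rw [← hzb, hzt]
    simp only [mem_sdiff, mem_insert, mem_singleton, not_or] at hz
    have hz' : z ∈ W \ {a', b'} := by simp [hz, hza, hzb]
    have : m z = m t := (hml hz' (by simp [hz])).trans hzt
    have := hm hz' ht this
    grind
  have collide : ∀ t u, (t = a ∨ t = b) → (u = a' ∨ u = b') → m t = l u → y = t ∨ y = u := by
    intro t u ht hu htu
    by_contra! hne
    have htm : t ∈ W \ {a', b'} := by rcases ht with rfl | rfl <;> assumption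
    have hul : u ∈ W \ {a, b} := by
      rcases hu with rfl | rfl
      · simp [haW', haa.symm, hba'.symm]
      · simp [hbW', hab'.symm, hbb.symm]
    have htr : t ∈ W \ {x, y} := by
      rcases ht with rfl | rfl
      · simp [haW, hxa.symm, hne.1.symm]
      · simp [hbW, hxb.symm, hne.1.symm]
    have hur : u ∈ W \ {x, y} := by
      rcases hu with rfl | rfl
      · simp [haW', hxa'.symm, hne.2.symm]
      · simp [hbW', hxb'.symm, hne.2.symm]
    have : r t = r u := (hrm htr htm).trans (htu.trans (hrl hur hul).symm)
    have := hr htr hur this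
    grind
  have hm_ne : m a ≠ m b := fun h => hab (hm ham hbm h)
  have ka := key a ham (Or.inl rfl)
  have kb := key b hbm (Or.inr rfl)
  have c1 := collide a a' (.inl rfl) (.inl rfl)
  have c2 := collide a b' (.inl rfl) (.inr rfl)
  have c3 := collide b a' (.inr rfl) (.inl rfl)
  have c4 := collide b b' (.inr rfl) (.inr rfl)
  rcases ka with ka | ka <;> rcases kb with kb | kb
  · exact hm_ne (ka.trans kb.symm)
  · have := c1 ka; have := c4 kb; grind
  · have := c2 ka; have := c3 kb; grind
  · exact hm_ne (ka.trans kb.symm)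

theorem card_nonisolated_le_four [Fintype V] [DecidableRel (labelGraph d ω W).Adj] (hd : 1 ≤ d)
    (hW : #W = d + 4) :
    #{v | 0 < (labelGraph d ω W).degree v} ≤ 4 := by
  have hex : ∀ v ∈ ({v | 0 < (labelGraph d ω W).degree v} : Finset V),
      ∃ w, (labelGraph d ω W).Adj v w := fun v hv =>
    ((labelGraph d ω W).degree_pos_iff_exists_adj v).1 (mem_filter.1 hv).2
  by_cases hE : ∃ a b, (labelGraph d ω W).Adj a b
  swap
  · rw [card_eq_zero.2 (eq_empty_of_forall_notMem fun v hv => hE ⟨v, hex v hv⟩)]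
    exact Nat.zero_le 4
  obtain ⟨a, b, hab⟩ := hE
  by_cases hdis : ∃ a' b', (labelGraph d ω W).Adj a' b' ∧ a ≠ a' ∧ a ≠ b' ∧ b ≠ a' ∧ b ≠ b'
  · obtain ⟨a', b', h', h1, h2, h3, h4⟩ := hdis
    calc _ ≤ #{a, b, a', b'} := by
          refine card_le_card fun v hv => ?_
          obtain ⟨w, hw⟩ := hex v hv
          simpa using labelGraph_adj_mem_of_disjoint hd hW hab h' hw h1 h2 h3 h4
      _ ≤ 4 := card_le_four
  · push Not at hdis
    have hdeg : ∀ v, #((labelGraph d ω W).neighborFinset v) ≤ 2 := by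
      intro v
      by_contra! h
      obtain ⟨x, y, z, hx, hy, hz, h1, h2, h3⟩ := two_lt_card_iff.1 h
      rw [SimpleGraph.mem_neighborFinset] at hx hy hz
      exact labelGraph_not_adj_three hd hW hx hy hz h1 h2 h3
    calc _ ≤ #((labelGraph d ω W).neighborFinset a ∪ (labelGraph d ω W).neighborFinset b) := by
          refine card_le_card fun v hv => ?_
          obtain ⟨w, hw⟩ := hex v hv
          have := hdis v w hw
          rw [mem_union, SimpleGraph.mem_neighborFinset, SimpleGraph.mem_neighborFinset]
          by_cases h1 : a = v
          · subst h1; exact .inr hab.symm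
          by_cases h2 : a = w
          · subst h2; exact .inl hw.symm
          by_cases h3 : b = v
          · subst h3; exact .inl hab
          · rw [this h1 h2 h3]; exact .inr hw.symm
      _ ≤ 4 := (card_union_le _ _).trans (Nat.add_le_add (hdeg a) (hdeg b))

open Classical in
/-- The `(d + 3)`-sets with an odd number of labelled facets. -/
noncomputable def oddHypergraph [Fintype V] (d : ℕ) (ω : Finset V × V → Option (Fin (d + 2))) :
    Finset (Finset V) :=
  {e | #e = d + 3 ∧ Odd #{v ∈ e | IsLabelled d ω (e.erase v)}}

theorem card_oddHypergraph_filter_subset [Fintype V] (hd : 1 ≤ d) (hW : #W = d + 4) :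
    #{e ∈ oddHypergraph d ω | e ⊆ W} ∈ ({0, 2, 4} : Set ℕ) := by
  classical
  set G := labelGraph d ω W
  have hdeg : ∀ v ∈ W, G.degree v = #{u ∈ W.erase v | IsLabelled d ω ((W.erase v).erase u)} := by
    intro v hv
    rw [← G.card_neighborFinset_eq_degree]
    congr 1
    ext u
    have : (W.erase v).erase u = W \ {v, u} := by
      ext; simp; tauto
    rw [SimpleGraph.mem_neighborFinset, mem_filter, mem_erase, this]
    change v ≠ u ∧ v ∈ W ∧ u ∈ W ∧ IsLabelled d ω (W \ {v, u}) ↔ _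
    tauto
  have heq : ({e ∈ oddHypergraph d ω | e ⊆ W} : Finset _) =
      ({v | Odd (G.degree v)} : Finset V).image (fun v => W.erase v) := by
    ext e
    simp only [oddHypergraph, mem_filter, mem_univ, true_and, mem_image]
    constructor
    · rintro ⟨⟨h1, h2⟩, h3⟩
      obtain ⟨v, hv⟩ : ∃ v, W \ e = {v} := by
        rw [← card_eq_one, card_sdiff_of_subset h3]; omega
      have hvW : v ∈ W := (mem_sdiff.1 (hv ▸ mem_singleton_self v)).1
      have he : W.erase v = e := by
        rw [← sdiff_singleton_eq_erase, ← hv, Finset.sdiff_sdiff_eq_self h3]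
      refine ⟨v, ?_, he⟩
      rw [hdeg v hvW, he]
      exact h2
    · rintro ⟨v, hv, rfl⟩
      have hvW : v ∈ W := by
        obtain ⟨w, hw⟩ := (G.degree_pos_iff_exists_adj v).1 hv.pos
        exact hw.2.1
      exact ⟨⟨by rw [card_erase_of_mem hvW, hW]; rfl, by rw [← hdeg v hvW]; exact hv⟩,
        erase_subset _ _⟩
  have hcard : #{e ∈ oddHypergraph d ω | e ⊆ W} = #{v | Odd (G.degree v)} := by
    rw [heq, card_image_of_injOn]
    intro v hv w hw h
    have hmem : ∀ v ∈ ({v | Odd (G.degree v)} : Finset V), v ∈ W := by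
      intro v hv
      obtain ⟨w, hw⟩ := (G.degree_pos_iff_exists_adj v).1 (mem_filter.1 hv).2.pos
      exact hw.2.1
    exact erase_injOn W (hmem v hv) (hmem w hw) h
  have h4 : #{v | Odd (G.degree v)} ≤ 4 :=
    (card_le_card (monotone_filter_right _ fun v _ hv => hv.pos)).trans
      (card_nonisolated_le_four hd hW)
  have he : Even #{v | Odd (G.degree v)} := G.even_card_odd_degree_vertices
  rw [hcard]
  simp only [Set.mem_insert_iff, Set.mem_singleton_iff]
  obtain ⟨r, hr⟩ := he
  omega

theorem mem_oddHypergraph_of_label [Fintype V] (hd : 1 ≤ d) {e : Finset V} (he : #e = d + 3)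
    (π : V → Option (Fin (d + 2))) (hπ : Set.InjOn π e)
    (h : ∀ Y ⊆ e, #Y = d → ∀ y ∈ Y, ω (Y, y) = π y) : e ∈ oddHypergraph d ω := by
  classical
  have himg : e.image π = univ := by
    apply eq_univ_of_card
    rw [card_image_of_injOn hπ, he]
    simp
  obtain ⟨v, hv, hvn⟩ := mem_image.1 (himg ▸ mem_univ none)
  have : ({u ∈ e | IsLabelled d ω (e.erase u)} : Finset V) = {v} := by
    ext u
    simp only [mem_filter, mem_singleton]
    constructor
    · rintro ⟨hu, l, -, hl⟩
      by_contra hne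
      obtain ⟨Y, h1, h2, h3⟩ := exists_subsuperset_card_eq (s := {v}) (t := e.erase u) (n := d)
        (by simp [hv, Ne.symm hne]) (by simpa using hd) (by rw [card_erase_of_mem hu]; omega)
      have hvY : v ∈ Y := h1 (mem_singleton_self v)
      have h4 := hl Y h2 h3 v hvY
      rw [h Y (h2.trans (erase_subset _ _)) h3 v hvY, hvn] at h4
      cases h4
    · rintro rfl
      have hsome : ∀ y ∈ e.erase u, π y = some ((π y).getD 0) := by
        intro y hy
        cases hy' : π y with
        | none => exact absurd (hπ (mem_of_mem_erase hy) hv (hy'.trans hvn.symm)) (ne_of_mem_erase hy)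
        | some z => rfl
      refine ⟨hv, fun y => (π y).getD 0, ?_, ?_⟩
      · intro y hy z hz hyz
        refine hπ (mem_of_mem_erase hy) (mem_of_mem_erase hz) ?_
        rw [hsome y hy, hsome z hz]
        exact congrArg some hyz
      · intro Y hY hc y hy
        rw [h Y (hY.trans (erase_subset _ _)) hc y hy]
        exact hsome y (hY hy)
  simp [oddHypergraph, he, this]

end

/-- The union bound: if there are few vertices, some colouring gives a hypergraph
with no independent set of size `n`. -/
theorem exists_coloring_forall_exists_edge (N n p d : ℕ) [Fact p.Prime] (hd : 1 ≤ d)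
    (hp : d + 3 ≤ p) (hpn : (d + 3) * p ≤ n)
    (h : (N : ℝ) ^ n *
      (1 - 1 / ((d + 3 : ℕ) : ℝ) ^ (2 ^ (d + 3) * (d + 3))) ^ (p ^ d) < 1) :
    ∃ ω : Finset (Fin N) × Fin N → Option (Fin (d + 2)),
      ∀ S : Finset (Fin N), #S = n → ∃ e ∈ oddHypergraph d ω, e ⊆ S := by
  classical
  set r : ℝ := (1 - 1 / ((d + 3 : ℕ) : ℝ) ^ (2 ^ (d + 3) * (d + 3))) ^ (p ^ d)
  set Ω := Finset (Fin N) × Fin N → Option (Fin (d + 2))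
  let bad (S : Finset (Fin N)) : Finset Ω := {ω | ∀ e ∈ oddHypergraph d ω, ¬ e ⊆ S}
  have hbad : ∀ S : Finset (Fin N), #S = n → (#(bad S) : ℝ) ≤ r * Fintype.card Ω := by
    intro S hS
    obtain ⟨s₀⟩ : Nonempty (Option (Fin (d + 2)) × ZMod p ↪ S) :=
      Function.Embedding.nonempty_of_card_le (by simpa [ZMod.card, hS] using hpn)
    let s : Option (Fin (d + 2)) × ZMod p ↪ Fin N := s₀.trans (Function.Embedding.subtype _)
    have hsS : ∀ x, s x ∈ S := fun x => (s₀ x).2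
    obtain ⟨c, hc⟩ := exists_transversal_family p d
      (by rw [Fintype.card_option, Fintype.card_fin]; exact hp) s
    let e (f : Fin d → ZMod p) : Finset (Fin N) := univ.image fun i => s (i, c f i)
    let π (v : Fin N) : Option (Fin (d + 2)) := (Function.invFun s v).1
    have hπ : ∀ x, π (s x) = x.1 := fun x =>
      congrArg Prod.fst (Function.leftInverse_invFun s.injective x)
    have hcard : ∀ f, #(e f) = d + 3 := by
      intro f
      rw [card_image_of_injective]
      · simp
      · intro i j hij
        exact congrArg Prod.fst (s.injective hij)
    let T (f : Fin d → ZMod p) : Finset (Finset (Fin N) × Fin N) :=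
      {t ∈ (e f).powerset ×ˢ e f | #t.1 = d ∧ t.2 ∈ t.1}
    have key := card_avoiding_le (fun t : Finset (Fin N) × Fin N => π t.2) T
      (2 ^ (d + 3) * (d + 3)) univ ?_ ?_
    · have hr : (#(univ : Finset (Fin d → ZMod p))) = p ^ d := by simp [ZMod.card]
      rw [hr, Fintype.card_option, Fintype.card_fin] at key
      refine le_trans ?_ key
      refine Nat.cast_le.2 (card_le_card fun ω hω => ?_)
      simp only [bad, mem_filter, mem_univ, true_and] at hω ⊢
      intro f _
      by_contra! hf
      refine hω (e f) (mem_oddHypergraph_of_label hd (hcard f) π ?_ ?_) ?_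
      · intro x hx y hy hxy
        obtain ⟨i, -, rfl⟩ := mem_image.1 hx
        obtain ⟨j, -, rfl⟩ := mem_image.1 hy
        rw [hπ, hπ] at hxy
        have : i = j := hxy
        rw [this]
      · intro Y hY hYd y hy
        exact hf (Y, y) (by simp [T, hY, hYd, hy, hY hy])
      · intro x hx
        obtain ⟨i, -, rfl⟩ := mem_image.1 hx
        exact hsS _
    · intro f _
      refine (card_filter_le _ _).trans ?_
      rw [card_product, card_powerset, hcard]
    · intro f _ g _ hfg
      refine disjoint_left.2 fun t ht ht' => hfg ?_
      simp only [T, mem_filter, mem_product, mem_powerset] at ht ht'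
      exact hc f g t.1 ht.2.1.ge ht.1.1 ht'.1.1
  have hr0 : 0 ≤ r := by
    refine pow_nonneg (sub_nonneg.2 ((div_le_one (by positivity)).2 (one_le_pow₀ ?_))) _
    push_cast
    linarith [(Nat.cast_nonneg d : (0 : ℝ) ≤ d)]
  have hΩ : (0 : ℝ) < Fintype.card Ω := by exact_mod_cast Fintype.card_pos
  have hlt : #((powersetCard n univ).biUnion bad) < Fintype.card Ω := by
    have h1 : (#((powersetCard n univ).biUnion bad) : ℝ) ≤
        (N : ℝ) ^ n * (r * Fintype.card Ω) := by
      calc (#((powersetCard n univ).biUnion bad) : ℝ)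
          ≤ ∑ S ∈ powersetCard n univ, (#(bad S) : ℝ) := by exact_mod_cast card_biUnion_le
        _ ≤ ∑ S ∈ powersetCard n (univ : Finset (Fin N)), r * Fintype.card Ω :=
          sum_le_sum fun S hS => hbad S (mem_powersetCard.1 hS).2
        _ = (N.choose n : ℝ) * (r * Fintype.card Ω) := by simp
        _ ≤ _ := by
          refine mul_le_mul_of_nonneg_right ?_ (by positivity)
          exact_mod_cast Nat.choose_le_pow N n
    have h2 : (N : ℝ) ^ n * (r * Fintype.card Ω) < Fintype.card Ω := by
      rw [← mul_assoc]
      exact mul_lt_of_lt_one_left hΩ h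
    exact_mod_cast h1.trans_lt h2
  obtain ⟨ω, hω⟩ : ∃ ω, ω ∉ (powersetCard n univ).biUnion bad := by
    by_contra! hall
    rw [eq_univ_of_forall hall, card_univ] at hlt
    exact lt_irrefl _ hlt
  refine ⟨ω, fun S hS => ?_⟩
  by_contra! hno
  exact hω (mem_biUnion.2 ⟨S, by simp [mem_powersetCard, hS], by simpa [bad] using hno⟩)

theorem ceil_two_rpow_pow_mul_lt_one {n d p K : ℕ} {q c : ℝ} (hd : 2 ≤ d) (hK : 0 < K)
    (hq1 : q ≤ 1) (hc : 0 < c) (hcq : c ≤ q / (2 * (2 * K) ^ d))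
    (hcn : 1 < c * (n : ℝ) ^ (d - 1)) (hpn : (n : ℝ) / (2 * K) ≤ p) :
    (⌈(2 : ℝ) ^ (c * (n : ℝ) ^ (d - 1))⌉₊ : ℝ) ^ n * (1 - q) ^ (p ^ d) < 1 := by
  set x := c * (n : ℝ) ^ (d - 1) with hx
  have hK' : (0 : ℝ) < K := by exact_mod_cast hK
  have hq : 0 < q := by
    have := hc.trans_le hcq
    by_contra! h
    exact absurd this (not_lt.2 (div_nonpos_of_nonpos_of_nonneg h (by positivity)))
  have hn : 0 < n := by
    rcases Nat.eq_zero_or_pos n with rfl | h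
    · rw [hx, Nat.cast_zero, zero_pow (by omega), mul_zero] at hcn
      linarith
    · exact h
  have h2x : (2 : ℝ) ≤ 2 ^ x := by
    simpa using Real.rpow_le_rpow_of_exponent_le (x := 2) (by norm_num) hcn.le
  have hN : (⌈(2 : ℝ) ^ x⌉₊ : ℝ) ≤ 2 ^ (2 * x) := by
    have h1 := (Nat.ceil_lt_add_one (by positivity : (0 : ℝ) ≤ 2 ^ x)).le
    have h2 : (2 : ℝ) ^ (2 * x) = 2 ^ x * 2 ^ x := by
      rw [two_mul, Real.rpow_add (by norm_num)]
    nlinarith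
  have hN' : (2 : ℝ) ^ (2 * x) < Real.exp (2 * x) := by
    rw [Real.rpow_def_of_pos (by norm_num)]
    refine Real.exp_lt_exp.2 ?_
    have := Real.log_two_lt_d9
    nlinarith
  have hxn : n * (2 * x) ≤ q * (p : ℝ) ^ d := by
    have h1 : (n : ℝ) * (2 * x) = 2 * c * n ^ d := by
      obtain ⟨t, rfl⟩ : ∃ t, d = t + 1 := ⟨d - 1, by omega⟩
      rw [hx, Nat.add_sub_cancel, pow_succ]
      ring
    rw [h1]
    calc 2 * c * (n : ℝ) ^ d ≤ 2 * (q / (2 * (2 * K) ^ d)) * (n : ℝ) ^ d := by gcongr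
      _ = q * ((n : ℝ) / (2 * K)) ^ d := by
        rw [div_pow]; field_simp
      _ ≤ _ := by gcongr
  have hpow : (1 - q) ^ (p ^ d) ≤ Real.exp (-(q * (p : ℝ) ^ d)) := by
    calc (1 - q) ^ (p ^ d) ≤ Real.exp (-q) ^ (p ^ d) :=
          pow_le_pow_left₀ (by linarith) (Real.one_sub_le_exp_neg q) _
      _ = _ := by
        rw [← Real.exp_nat_mul]
        congr 1
        push_cast
        ring
  calc _ ≤ (⌈(2 : ℝ) ^ x⌉₊ : ℝ) ^ n * Real.exp (-(q * (p : ℝ) ^ d)) := by gcongr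
    _ < Real.exp (2 * x) ^ n * Real.exp (-(q * (p : ℝ) ^ d)) := by
      refine mul_lt_mul_of_pos_right ?_ (Real.exp_pos _)
      exact pow_lt_pow_left₀ (hN.trans_lt hN') (Nat.cast_nonneg _) hn.ne'
    _ = Real.exp (n * (2 * x) - q * (p : ℝ) ^ d) := by
      rw [← Real.exp_nat_mul, ← Real.exp_add, sub_eq_add_neg]
    _ ≤ 1 := Real.exp_le_one_iff.2 (by linarith)


/-- For every integer `k ≥ 5` there exists a constant `c > 0` such that
for every integer `n ≥ k` there is a `k`-uniform hypergraph `H` on a vertex set of size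
at least `2 ^ (c * n ^ (k - 4))` in which every `(k+1)`-element subset of the vertices
induces exactly 0, 2, or 4 edges, and which has no independent set of size `n`. -/
theorem g_lower_bound (k : ℕ) (hk : 5 ≤ k) :
    ∃ c : ℝ, 0 < c ∧ ∀ n : ℕ, k ≤ n →
      ∃ N : ℕ, (N : ℝ) ≥ (2 : ℝ) ^ (c * (n : ℝ) ^ (k - 4)) ∧
        ∃ H : Finset (Finset (Fin N)),
          (∀ e ∈ H, e.card = k) ∧
          (∀ S : Finset (Fin N), S.card = k + 1 →
            (H.filter (· ⊆ S)).card ∈ ({0, 2, 4} : Set ℕ)) ∧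
          (∀ S : Finset (Fin N), S.card = n → ∃ e ∈ H, e ⊆ S) := by
  obtain ⟨d, rfl⟩ : ∃ d, k = d + 3 := ⟨k - 3, by omega⟩
  have hd : 1 ≤ d := by omega
  have hk4 : d + 3 - 4 = d - 1 := by omega
  rw [hk4]
  set K := d + 3 with hK
  set q : ℝ := 1 / ((K : ℕ) : ℝ) ^ (2 ^ K * K) with hq
  have hK1 : (1 : ℝ) ≤ K := by exact_mod_cast (by omega : 1 ≤ K)
  have hq0 : 0 < q := by positivity
  have hq1 : q ≤ 1 := (div_le_one (by positivity)).2 (one_le_pow₀ hK1)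
  set c : ℝ := min (q / (2 * (2 * K) ^ d)) (1 / (2 * K ^ 2) ^ (d - 1)) with hc
  have hc0 : 0 < c := lt_min (by positivity) (by positivity)
  refine ⟨c, hc0, fun n hn => ?_⟩
  rcases le_or_gt (c * (n : ℝ) ^ (d - 1)) 1 with hsmall | hbig
  · refine ⟨2, ?_, ∅, by simp, by simp, fun S hS => ?_⟩
    · simpa using Real.rpow_le_rpow_of_exponent_le (x := 2) (by norm_num) hsmall
    · have := S.card_le_univ
      rw [Fintype.card_fin] at this
      omega
  · have hn2 : 2 * K ^ 2 < n := by
      have h1 : (2 * (K : ℝ) ^ 2) ^ (d - 1) < (n : ℝ) ^ (d - 1) := by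
        have h2 : c * (n : ℝ) ^ (d - 1) ≤ 1 / (2 * (K : ℝ) ^ 2) ^ (d - 1) * (n : ℝ) ^ (d - 1) :=
          mul_le_mul_of_nonneg_right (min_le_right _ _) (by positivity)
        have h3 := hbig.trans_le h2
        rwa [one_div, inv_mul_eq_div, one_lt_div (by positivity)] at h3
      exact_mod_cast lt_of_pow_lt_pow_left₀ _ (Nat.cast_nonneg n) h1
    have hKpos : 0 < 2 * K := by omega
    have hKr : K ≤ n / (2 * K) := (Nat.le_div_iff_mul_le hKpos).2 (by nlinarith)
    obtain ⟨p, hp, h1, h2⟩ := Nat.exists_prime_lt_and_le_two_mul (n / (2 * K)) (by omega)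
    have : Fact p.Prime := ⟨hp⟩
    have hnp : (n : ℝ) / (2 * K) ≤ p := by
      rw [div_le_iff₀ (by positivity)]
      have := (Nat.div_lt_iff_lt_mul hKpos).1 h1
      exact_mod_cast this.le
    have hKp : K * p ≤ n := by
      calc K * p ≤ K * (2 * (n / (2 * K))) := Nat.mul_le_mul_left _ h2
        _ = n / (2 * K) * (2 * K) := by ring
        _ ≤ n := Nat.div_mul_le_self _ _
    obtain ⟨ω, hω⟩ := exists_coloring_forall_exists_edge _ n p d hd (by omega) hKp
      (ceil_two_rpow_pow_mul_lt_one (K := K) (by omega) (by omega) hq1 hc0 (min_le_left _ _) hbig hnp)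
    refine ⟨_, Nat.le_ceil _, oddHypergraph d ω, fun e he => ?_, fun S hS => ?_, hω⟩
    · simp only [oddHypergraph, mem_filter] at he
      exact he.2.1
    · exact card_oddHypergraph_filter_subset hd hS
end

section
/- For all integers k ≥ 5 and 1 ≤ t ≤ k there exists a constant c' > 0 (depending only on k and t) such that for every integer n ≥ k, every k-uniform hypergraph on at least twr_t(c'·n^(k−t)·log n) vertices with the property that every set of k+1 vertices induces at most t edges contains an independent set of size n. Here twr is the tower function defined by twr_1(x) = x and twr_{i+1}(x) = 2^(twr_i(x)). -/
/-- The tower function: `twr 1 x = x` and `twr (i+1) x = 2 ^ twr i x`. -/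
noncomputable def twr : ℕ → ℝ → ℝ
  | 0, x => x
  | 1, x => x
  | (n + 2), x => (2 : ℝ) ^ twr (n + 1) x

/-- `IndepIn H r I`: no `r`-element subset of `I` is an edge of `H`. -/
def IndepIn {α : Type*} (H : Finset α → Prop) (r : ℕ) (I : Finset α) : Prop :=
  ∀ e ⊆ I, e.card = r → ¬ H e

open Classical in
/-- An ordered form of the local sparsity condition: inside `A`, every `r + 1` vertices whose
initial `r`-subset `S` is an edge span at most `s` edges (`S` and those containing the last
vertex `x`). -/
def InitialSparse {α : Type*} [LinearOrder α] (H : Finset α → Prop) (s r : ℕ) (A : Finset α) :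
    Prop :=
  ∀ S ⊆ A, ∀ x ∈ A, (∀ y ∈ S, y < x) → S.card = r → H S →
    (S.filter fun y => H (insert x (S.erase y))).card + 1 ≤ s

/-- Every `r`-uniform hypergraph on at least `N` ordered vertices which is `InitialSparse` with
parameter `s` has an independent set of size `n`. -/
def ForcesIndep (α : Type*) [LinearOrder α] (s r n N : ℕ) : Prop :=
  ∀ (H : Finset α → Prop) (A : Finset α), N ≤ A.card → InitialSparse H s r A →
    ∃ I ⊆ A, I.card = n ∧ IndepIn H r I

theorem IndepIn.insert {α : Type*} [DecidableEq α] {H : Finset α → Prop} {r : ℕ} {I : Finset α}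
    {v : α} (hI : IndepIn H (r + 1) I) (hv : ∀ S ⊆ I, S.card = r → ¬ H (insert v S)) :
    IndepIn H (r + 1) (insert v I) := by
  intro e he hcard
  by_cases hve : v ∈ e
  · have h1 : e.erase v ⊆ I := by
      intro y hy
      have := he (Finset.mem_of_mem_erase hy)
      exact (Finset.mem_insert.1 this).resolve_left (Finset.ne_of_mem_erase hy)
    have := hv _ h1 (by rw [Finset.card_erase_of_mem hve, hcard]; rfl)
    rwa [Finset.insert_erase hve] at this
  · exact hI e ((Finset.subset_insert_iff_of_notMem hve).1 he) hcard

/-- If all `insert a (insert v T)` with `a ∈ A` are edges, then sparsity with parameter `2` makes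
`insert b (insert a T)` a non-edge for all `a < b` in `A`. -/
theorem InitialSparse.not_edge_of_common {α : Type*} [LinearOrder α] {H : Finset α → Prop}
    {q : ℕ} {V T A : Finset α} {v : α} (hH : InitialSparse H 2 (q + 2) V) (hT : T ⊆ V)
    (hTcard : T.card = q) (hv : v ∈ V) (hTv : ∀ y ∈ T, y < v) (hA : A ⊆ V)
    (hvA : ∀ a ∈ A, v < a) (hedge : ∀ a ∈ A, H (insert a (insert v T))) :
    ∀ a ∈ A, ∀ b ∈ A, a < b → ¬ H (insert b (insert a T)) := by
  classical
  intro a ha b hb hab hbad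
  have hva := hvA a ha
  have hvT : v ∉ T := fun h => lt_irrefl _ (hTv v h)
  have haT : a ∉ insert v T := by
    intro h
    rcases Finset.mem_insert.1 h with h | h
    · exact hva.ne' h
    · exact lt_asymm hva (hTv a h)
  have haT' : a ∉ T := fun h => haT (Finset.mem_insert_of_mem h)
  have key := hH (insert a (insert v T))
    (Finset.insert_subset (hA ha) (Finset.insert_subset hv hT)) b (hA hb)
    (by
      intro y hy
      rcases Finset.mem_insert.1 hy with rfl | hy
      · exact hab
      · rcases Finset.mem_insert.1 hy with rfl | hy
        · exact hva.trans hab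
        · exact (hTv y hy).trans (hva.trans hab))
    (by rw [Finset.card_insert_of_notMem haT, Finset.card_insert_of_notMem hvT, hTcard])
    (hedge a ha)
  have hsub : ({v, a} : Finset α) ⊆
      (insert a (insert v T)).filter
        fun y => H (insert b ((insert a (insert v T)).erase y)) := by
    intro y hy
    rcases Finset.mem_insert.1 hy with rfl | hy
    · refine Finset.mem_filter.2 ⟨by simp, ?_⟩
      rw [Finset.insert_comm, Finset.erase_insert]
      · exact hbad
      · simp [hvT, hva.ne]
    · obtain rfl := Finset.mem_singleton.1 hy
      refine Finset.mem_filter.2 ⟨by simp, ?_⟩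
      rw [Finset.erase_insert haT]
      exact hedge b hb
  have h2 := Finset.card_le_card hsub
  rw [Finset.card_pair hva.ne] at h2
  omega

/-- The greedy construction behind `forcesIndep_two`. Here `I` is the independent set built so
far, `A` the set of remaining candidates and `R` a family of `q`-subsets `T` of `I` for which
no `insert b (insert a T)` with `a < b` in `A` is an edge. -/
theorem exists_indepIn_extending {α : Type*} [LinearOrder α] {H : Finset α → Prop} {q n : ℕ}
    {V : Finset α} (hH : InitialSparse H 2 (q + 2) V) :
    ∀ (N : ℕ) (A I : Finset α) (R : Finset (Finset α)) (p : ℕ), A.card = N → A ⊆ V → I ⊆ V →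
      (∀ i ∈ I, ∀ a ∈ A, i < a) → IndepIn H (q + 2) I →
      (∀ S ⊆ I, S.card = q + 1 → ∀ a ∈ A, ¬ H (insert a S)) →
      R ⊆ I.powersetCard q →
      (∀ T ∈ R, ∀ a ∈ A, ∀ b ∈ A, a < b → ¬ H (insert b (insert a T))) →
      R.card + p = n.choose q → I.card ≤ n →
      (n - I.card) * ((n ^ q + 1) * (n * (n ^ q + 1)) ^ p) ≤ A.card →
      ∃ J ⊆ V, J.card = n ∧ IndepIn H (q + 2) J := by
  classical
  intro N
  induction N using Nat.strong_induction_on with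
  | _ N ih =>
  intro A I R p hAN hAV hIV hIA hI hlink hR hRA hp hIn hsize
  rcases hIn.eq_or_lt with hIn | hIn
  · exact ⟨I, hIV, hIn, hI⟩
  set d := (n * (n ^ q + 1)) ^ p with hd
  have hn : 0 < n := by omega
  have hdpos : 0 < d := by positivity
  obtain ⟨j, hj⟩ : ∃ j, n - I.card = j + 1 := ⟨n - I.card - 1, by omega⟩
  rw [hj] at hsize
  have hApos : 0 < A.card := by
    refine lt_of_lt_of_le ?_ hsize
    positivity
  have hAne : A.Nonempty := Finset.card_pos.1 hApos
  set v := A.min' hAne with hvdef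
  have hvA : v ∈ A := Finset.min'_mem _ _
  have hvlt : ∀ a ∈ A.erase v, v < a := fun a ha =>
    lt_of_le_of_ne (Finset.min'_le _ _ (Finset.mem_of_mem_erase ha))
      (Finset.ne_of_mem_erase ha).symm
  have hvI : v ∉ I := fun h => lt_irrefl _ (hIA v h v hvA)
  let nb : Finset α → Finset α := fun T => (A.erase v).filter fun a => H (insert a (insert v T))
  have hnb : ∀ T, nb T ⊆ A.erase v := fun T => Finset.filter_subset _ _
  by_cases hfail : ∃ T ∈ I.powersetCard q \ R, d ≤ (nb T).card
  · obtain ⟨T, hT, hTd⟩ := hfail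
    obtain ⟨hTI, hTR⟩ := Finset.mem_sdiff.1 hT
    have hTI' := Finset.mem_powersetCard.1 hTI
    have hnbA : nb T ⊆ A := (hnb T).trans (Finset.erase_subset _ _)
    have hcardR : R.card + 1 ≤ n.choose q := by
      have h1 : (insert T R).card ≤ (I.powersetCard q).card :=
        Finset.card_le_card (Finset.insert_subset hTI hR)
      rw [Finset.card_insert_of_notMem hTR, Finset.card_powersetCard] at h1
      exact h1.trans (Nat.choose_le_choose q hIn.le)
    obtain ⟨p', rfl⟩ : ∃ p', p = p' + 1 := ⟨p - 1, by omega⟩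
    refine ih (nb T).card ?_ (nb T) I (insert T R) p' rfl (hnbA.trans hAV) hIV
      (fun i hi a ha => hIA i hi a (hnbA ha)) hI
      (fun S hS hSc a ha => hlink S hS hSc a (hnbA ha)) (Finset.insert_subset hTI hR) ?_ ?_
      hIn.le ?_
    · rw [← hAN]
      exact (Finset.card_le_card (hnb T)).trans_lt (Finset.card_erase_lt_of_mem hvA)
    · intro U hU
      rcases Finset.mem_insert.1 hU with rfl | hU
      · exact hH.not_edge_of_common (hTI'.1.trans hIV) hTI'.2 (hAV hvA)
          (fun y hy => hIA y (hTI'.1 hy) v hvA) (hnbA.trans hAV)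
          (fun a ha => hvlt a (hnb _ ha)) (fun a ha => (Finset.mem_filter.1 ha).2)
      · exact fun a ha b hb => hRA U hU a (hnbA ha) b (hnbA hb)
    · rw [Finset.card_insert_of_notMem hTR]
      omega
    · refine le_trans ?_ hTd
      rw [hd, pow_succ']
      calc (n - I.card) * ((n ^ q + 1) * (n * (n ^ q + 1)) ^ p')
          ≤ n * ((n ^ q + 1) * (n * (n ^ q + 1)) ^ p') :=
            Nat.mul_le_mul_right _ (Nat.sub_le _ _)
        _ = _ := by ring
  · push Not at hfail
    set bad := (I.powersetCard q \ R).biUnion nb with hbad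
    have hbadcard : bad.card ≤ n ^ q * d := by
      refine (Finset.card_biUnion_le_card_mul _ _ d fun T hT => (hfail T hT).le).trans ?_
      refine Nat.mul_le_mul_right _ ?_
      refine (Finset.card_le_card Finset.sdiff_subset).trans ?_
      rw [Finset.card_powersetCard]
      exact (Nat.choose_le_pow _ _).trans (Nat.pow_le_pow_left hIn.le q)
    have hA'A : (A.erase v) \ bad ⊆ A := Finset.sdiff_subset.trans (Finset.erase_subset _ _)
    have hnew : ∀ T ⊆ I, T.card = q → ∀ a ∈ A.erase v \ bad, ¬ H (insert a (insert v T)) := by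
      intro T hTI hTc a ha hedge
      obtain ⟨haA, habad⟩ := Finset.mem_sdiff.1 ha
      by_cases hTR : T ∈ R
      · exact hRA T hTR v hvA a (Finset.mem_of_mem_erase haA) (hvlt a haA) hedge
      · exact habad (Finset.mem_biUnion.2 ⟨T, Finset.mem_sdiff.2
          ⟨Finset.mem_powersetCard.2 ⟨hTI, hTc⟩, hTR⟩, Finset.mem_filter.2 ⟨haA, hedge⟩⟩)
    refine ih (A.erase v \ bad).card ?_ (A.erase v \ bad) (insert v I) R p rfl
      (hA'A.trans hAV) (Finset.insert_subset (hAV hvA) hIV) ?_ ?_ ?_ ?_ ?_ hp ?_ ?_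
    · rw [← hAN]
      exact (Finset.card_le_card Finset.sdiff_subset).trans_lt (Finset.card_erase_lt_of_mem hvA)
    · intro i hi a ha
      rcases Finset.mem_insert.1 hi with rfl | hi
      · exact hvlt a (Finset.mem_sdiff.1 ha).1
      · exact hIA i hi a (hA'A ha)
    · exact hI.insert fun S hS hSc => hlink S hS hSc v hvA
    · intro S hS hSc a ha
      by_cases hvS : v ∈ S
      · have h1 : S.erase v ⊆ I := by
          intro y hy
          exact (Finset.mem_insert.1 (hS (Finset.mem_of_mem_erase hy))).resolve_left
            (Finset.ne_of_mem_erase hy)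
        have := hnew _ h1 (by rw [Finset.card_erase_of_mem hvS, hSc]; rfl) a ha
        rwa [Finset.insert_erase hvS] at this
      · exact hlink S ((Finset.subset_insert_iff_of_notMem hvS).1 hS) hSc a (hA'A ha)
    · exact hR.trans (Finset.powersetCard_mono (Finset.subset_insert _ _))
    · exact fun T hT a ha b hb => hRA T hT a (hA'A ha) b (hA'A hb)
    · rw [Finset.card_insert_of_notMem hvI]
      exact hIn
    · have h1 : (A.erase v).card - bad.card ≤ (A.erase v \ bad).card :=
        Finset.le_card_sdiff _ _
      rw [Finset.card_erase_of_mem hvA] at h1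
      have h2 : n - (insert v I).card = j := by
        rw [Finset.card_insert_of_notMem hvI]
        omega
      rw [h2, ← hd]
      have h3 : (j + 1) * ((n ^ q + 1) * d) = j * ((n ^ q + 1) * d) + n ^ q * d + d := by ring
      omega

theorem forcesIndep_two (α : Type*) [LinearOrder α] (q n : ℕ) :
    ForcesIndep α 2 (q + 2) n ((n * (n ^ q + 1)) ^ (n ^ q + 1)) := by
  intro H A hA hH
  rcases Nat.eq_zero_or_pos n with rfl | hn
  · refine ⟨∅, by simp, rfl, fun e he hc => ?_⟩
    rw [Finset.subset_empty.1 he] at hc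
    simp at hc
  refine exists_indepIn_extending hH A.card A ∅ ∅ (n.choose q) rfl subset_rfl (by simp) (by simp)
    ?_ ?_ (by simp) (by simp) (by simp) (by simp) ?_
  · intro e he hc
    rw [Finset.subset_empty.1 he] at hc
    simp at hc
  · intro e he hc
    rw [Finset.subset_empty.1 he] at hc
    simp at hc
  · refine le_trans ?_ hA
    have hpos : 0 < n * (n ^ q + 1) := by positivity
    calc (n - (∅ : Finset α).card) * ((n ^ q + 1) * (n * (n ^ q + 1)) ^ n.choose q)
        = (n * (n ^ q + 1)) ^ (n.choose q + 1) := by simp; ring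
      _ ≤ _ := Nat.pow_le_pow_right hpos (Nat.succ_le_succ (Nat.choose_le_pow _ _))

/-- The Erdős–Rado argument: a large ordered vertex set contains `B` and a later vertex `x` such
that adjacency of a `(q + 1)`-subset of `B ∪ {x}` does not depend on its last vertex. -/
theorem exists_end_homogeneous {α : Type*} [LinearOrder α] (H : Finset α → Prop) (q m : ℕ) :
    ∀ (j : ℕ) (A B : Finset α), B.card + j = m → (2 * 2 ^ m ^ q) ^ j ≤ A.card →
      (∀ b ∈ B, ∀ a ∈ A, b < a) →
      (∀ f ⊆ B, f.card = q → ∀ y ∈ B ∪ A, (∀ z ∈ f, z < y) → ∀ a ∈ A,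
        (H (insert y f) ↔ H (insert a f))) →
      ∃ C ⊆ B ∪ A, C.card = m ∧ ∃ x ∈ A, (∀ b ∈ C, b < x) ∧
        ∀ f ⊆ C, f.card = q → ∀ y ∈ C, (∀ z ∈ f, z < y) →
          (H (insert y f) ↔ H (insert x f)) := by
  classical
  intro j
  induction j with
  | zero =>
    intro A B hB hA hBA hhom
    obtain ⟨x, hx⟩ : A.Nonempty := Finset.card_pos.1 (by simpa using hA)
    exact ⟨B, Finset.subset_union_left, by simpa using hB, x, hx, fun b hb => hBA b hb x hx,
      fun f hf hq y hy hfy => hhom f hf hq y (Finset.mem_union_left _ hy) hfy x hx⟩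
  | succ j ih =>
    intro A B hB hA hBA hhom
    have hpos : 0 < (2 * 2 ^ m ^ q) ^ j := by positivity
    have hAne : A.Nonempty := Finset.card_pos.1 (lt_of_lt_of_le (by positivity) hA)
    set v := A.min' hAne with hvdef
    have hvA : v ∈ A := Finset.min'_mem _ _
    have hvlt : ∀ a ∈ A.erase v, v < a := fun a ha =>
      lt_of_le_of_ne (Finset.min'_le _ _ (Finset.mem_of_mem_erase ha))
        (Finset.ne_of_mem_erase ha).symm
    have hvB : v ∉ B := fun h => lt_irrefl _ (hBA v h v hvA)
    let pat : α → Finset (Finset α) := fun a =>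
      ((insert v B).powersetCard q).filter fun f => H (insert a f)
    have hcardB : (insert v B).card = B.card + 1 := Finset.card_insert_of_notMem hvB
    have hmaps : ∀ a ∈ A.erase v, pat a ∈ ((insert v B).powersetCard q).powerset :=
      fun a _ => Finset.mem_powerset.2 (Finset.filter_subset _ _)
    have hcount : ((insert v B).powersetCard q).powerset.card * (2 * 2 ^ m ^ q) ^ j ≤
        (A.erase v).card := by
      have h1 : ((insert v B).powersetCard q).powerset.card ≤ 2 ^ m ^ q := by
        rw [Finset.card_powerset, Finset.card_powersetCard]
        refine Nat.pow_le_pow_right two_pos ((Nat.choose_le_pow _ _).trans ?_)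
        exact Nat.pow_le_pow_left (by omega) q
      refine (Nat.mul_le_mul_right _ h1).trans ?_
      rw [Finset.card_erase_of_mem hvA]
      have h2 : (2 * 2 ^ m ^ q) ^ (j + 1) =
          2 ^ m ^ q * (2 * 2 ^ m ^ q) ^ j + 2 ^ m ^ q * (2 * 2 ^ m ^ q) ^ j := by ring
      have h3 : 0 < 2 ^ m ^ q * (2 * 2 ^ m ^ q) ^ j := by positivity
      omega
    obtain ⟨P, -, hPcard⟩ := Finset.exists_le_card_fiber_of_mul_le_card_of_maps_to hmaps
      ⟨_, Finset.empty_mem_powerset _⟩ hcount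
    set A' := (A.erase v).filter fun a => pat a = P with hA'
    have hA'e : A' ⊆ A.erase v := Finset.filter_subset _ _
    have hA'A : A' ⊆ A := hA'e.trans (Finset.erase_subset _ _)
    have hsub : insert v B ∪ A' ⊆ B ∪ A := by
      refine Finset.union_subset (Finset.insert_subset (Finset.mem_union_right _ hvA)
        Finset.subset_union_left) (hA'A.trans Finset.subset_union_right)
    obtain ⟨C, hC, hCm, x, hx, hCx, hCh⟩ := ih A' (insert v B) (by omega) hPcard
      (by
        intro b hb a ha
        rcases Finset.mem_insert.1 hb with rfl | hb
        · exact hvlt a (hA'e ha)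
        · exact hBA b hb a (hA'A ha))
      (by
        intro f hf hfq y hy hfy a ha
        rcases Finset.mem_union.1 hy with hyB | hyA
        · have hfB : f ⊆ B := by
            intro z hz
            refine (Finset.mem_insert.1 (hf hz)).resolve_left ?_
            rintro rfl
            rcases Finset.mem_insert.1 hyB with rfl | hyB
            · exact lt_irrefl _ (hfy _ hz)
            · exact lt_asymm (hfy _ hz) (hBA y hyB _ hvA)
          exact hhom f hfB hfq y (hsub hy) hfy a (hA'A ha)
        · have h1 : pat y = pat a :=
            (Finset.mem_filter.1 hyA).2.trans (Finset.mem_filter.1 ha).2.symm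
          have hf' : f ∈ (insert v B).powersetCard q := Finset.mem_powersetCard.2 ⟨hf, hfq⟩
          have h2 : f ∈ pat y ↔ f ∈ pat a := by rw [h1]
          simpa [pat, hf', Finset.mem_powersetCard.1 hf'] using h2)
    exact ⟨C, hC.trans hsub, hCm, x, hA'A hx, hCx, hCh⟩

theorem ForcesIndep.step {α : Type*} [LinearOrder α] {s r n m : ℕ} (hr : r ≠ 0)
    (h : ForcesIndep α s r n m) :
    ForcesIndep α (s + 1) (r + 1) n ((2 * 2 ^ m ^ r) ^ m) := by
  classical
  intro H A hA hH
  obtain ⟨C, hC, hCm, x, hx, hCx, hCh⟩ := exists_end_homogeneous H r m m A ∅ (by simp) hA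
    (by simp) (by
      intro f hf hfr
      rw [Finset.subset_empty.1 hf] at hfr
      exact absurd hfr.symm hr)
  rw [Finset.empty_union] at hC
  obtain ⟨I, hIC, hIn, hI⟩ := h (fun f => H (insert x f)) C hCm.ge (by
    intro S hS y hy hSy hSr hSx
    have hyS : y ∉ S := fun hyS => lt_irrefl _ (hSy y hyS)
    have key := hH (insert y S) ((Finset.insert_subset hy hS).trans hC) x hx
      (fun z hz => hCx z (Finset.insert_subset hy hS hz))
      (by rw [Finset.card_insert_of_notMem hyS, hSr]) ((hCh S hS hSr y hy hSy).2 hSx)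
    have hsub : insert y (S.filter fun z => H (insert x (insert y (S.erase z)))) ⊆
        (insert y S).filter fun z => H (insert x ((insert y S).erase z)) := by
      intro z hz
      rcases Finset.mem_insert.1 hz with rfl | hz
      · refine Finset.mem_filter.2 ⟨Finset.mem_insert_self _ _, ?_⟩
        rwa [Finset.erase_insert hyS]
      · obtain ⟨hzS, hz⟩ := Finset.mem_filter.1 hz
        refine Finset.mem_filter.2 ⟨Finset.mem_insert_of_mem hzS, ?_⟩
        rwa [Finset.erase_insert_of_ne]
        rintro rfl
        exact hyS hzS
    have h1 := Finset.card_le_card hsub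
    rw [Finset.card_insert_of_notMem fun hz => hyS (Finset.mem_filter.1 hz).1] at h1
    have h2 : (S.filter fun z => H (insert x (insert y (S.erase z)))).card + 1 + 1 ≤ s + 1 :=
      (Nat.succ_le_succ h1).trans (by convert key)
    convert Nat.le_of_succ_le_succ h2)
  refine ⟨I, hIC.trans hC, hIn, ?_⟩
  intro e he her hedge
  have hene : e.Nonempty := Finset.card_pos.1 (by omega)
  have hmax := Finset.max'_mem e hene
  have hsub : e.erase (e.max' hene) ⊆ I := (Finset.erase_subset _ _).trans he
  have hcard : (e.erase (e.max' hene)).card = r := by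
    rw [Finset.card_erase_of_mem hmax, her]; rfl
  refine hI _ hsub hcard ?_
  change H (insert x (e.erase (e.max' hene)))
  rw [← hCh _ (hsub.trans hIC) hcard _ (hIC (he hmax))
    (fun z hz => Finset.lt_max'_of_mem_erase_max' _ _ hz), Finset.insert_erase hmax]
  exact hedge

theorem ForcesIndep.mono {α : Type*} [LinearOrder α] {s r n m m' : ℕ}
    (h : ForcesIndep α s r n m) (hm : m ≤ m') : ForcesIndep α s r n m' :=
  fun H A hA hH => h H A (hm.trans hA) hH

theorem twr_add_two (j : ℕ) (x : ℝ) : twr (j + 2) x = 2 ^ twr (j + 1) x := rfl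

theorem twr_one (x : ℝ) : twr 1 x = x := rfl

theorem twr_pos (j : ℕ) {x : ℝ} (hx : 0 < x) : 0 < twr j x := by
  match j with
  | 0 => exact hx
  | 1 => exact hx
  | j + 2 => exact Real.rpow_pos_of_pos two_pos _

theorem one_le_twr (j : ℕ) {x : ℝ} (hx : 0 < x) : 1 ≤ twr (j + 2) x :=
  Real.one_le_rpow one_le_two (twr_pos _ hx).le

/-- Polynomial factors are absorbed by a constant in the top of a tower of height at least two. -/
theorem exists_twr_ge_pow (j : ℕ) : ∀ (D : ℕ) {c : ℝ}, 0 < c → ∃ c' : ℝ, 0 < c' ∧ ∀ x : ℝ, 1 ≤ x →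
    2 * (twr (j + 2) (c * x) + 1) ^ D ≤ twr (j + 2) (c' * x) := by
  have aux : ∀ (D : ℕ) (y : ℝ), 0 ≤ y →
      2 * ((2 : ℝ) ^ y + 1) ^ D ≤ (2 : ℝ) ^ ((y + 1) * D + 1) := by
    intro D y hy
    have h1 : (1 : ℝ) ≤ 2 ^ y := Real.one_le_rpow one_le_two hy
    have h2 : (2 : ℝ) ^ y + 1 ≤ 2 ^ (y + 1) := by
      rw [Real.rpow_add_one two_ne_zero]; linarith
    rw [Real.rpow_add_one two_ne_zero, Real.rpow_mul_natCast zero_le_two, mul_comm]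
    gcongr
  induction j with
  | zero =>
    intro D c hc
    refine ⟨(c + 1) * D + 1, by positivity, fun x hx => ?_⟩
    simp only [twr_add_two, zero_add, twr_one]
    refine (aux D (c * x) (by positivity)).trans ?_
    refine Real.rpow_le_rpow_of_exponent_le one_le_two ?_
    have : (0 : ℝ) ≤ D := Nat.cast_nonneg D
    nlinarith [mul_nonneg this (sub_nonneg.2 hx)]
  | succ j ih =>
    intro D c hc
    obtain ⟨c', hc', h⟩ := ih (D + 1) hc
    refine ⟨c', hc', fun x hx => ?_⟩
    have hy := one_le_twr j (mul_pos hc (zero_lt_one.trans_le hx))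
    have hx' := h x hx
    rw [twr_add_two (j + 1), twr_add_two (j + 1)]
    set y := twr (j + 2) (c * x) with hydef
    refine (aux D y (by linarith)).trans ?_
    refine Real.rpow_le_rpow_of_exponent_le one_le_two (le_trans ?_ hx')
    have h1 : (D : ℝ) + 1 ≤ (y + 1) ^ D := by
      have h2 : ((D : ℝ) + 1) ≤ 2 ^ D := by exact_mod_cast Nat.lt_two_pow_self
      refine h2.trans ?_
      gcongr
      linarith
    rw [pow_succ]
    have hD : (0 : ℝ) ≤ D := Nat.cast_nonneg D
    nlinarith [mul_le_mul_of_nonneg_right h1 (by linarith : (0 : ℝ) ≤ y + 1)]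

theorem one_le_log_of_three_le {n : ℕ} (hn : 3 ≤ n) : 1 ≤ Real.log n := by
  have h3 : (3 : ℝ) ≤ n := by exact_mod_cast hn
  rw [Real.le_log_iff_exp_le (by linarith)]
  linarith [Real.exp_one_lt_d9]

theorem base_le_twr {q n : ℕ} (hn : 3 ≤ n) :
    (((n * (n ^ q + 1)) ^ (n ^ q + 1) : ℕ) : ℝ) ≤
      twr 2 (4 * (q + 2) * ((n : ℝ) ^ q * Real.log n)) := by
  have hlog := one_le_log_of_three_le hn
  have hn0 : (0 : ℝ) < n := by exact_mod_cast (by omega : 0 < n)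
  have hq1 : 1 ≤ n ^ q := Nat.one_le_pow _ _ (by omega)
  have h1 : (n * (n ^ q + 1)) ^ (n ^ q + 1) ≤ n ^ ((q + 2) * (2 * n ^ q)) := by
    rw [pow_mul]
    have h2 : n * (n ^ q + 1) ≤ n ^ (q + 2) := by
      have h3 : n ^ (q + 2) = n * (n ^ q * n) := by ring
      rw [h3]
      exact Nat.mul_le_mul_left _ (by nlinarith)
    refine (Nat.pow_le_pow_left h2 _).trans (Nat.pow_le_pow_right ?_ (by omega))
    exact Nat.pow_pos (by omega)
  have h4 : (((n * (n ^ q + 1)) ^ (n ^ q + 1) : ℕ) : ℝ) ≤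
      (n : ℝ) ^ ((q + 2) * (2 * n ^ q)) := by exact_mod_cast h1
  refine h4.trans ?_
  rw [twr_add_two 0, zero_add, twr_one,
    Real.rpow_def_of_pos two_pos, ← Real.rpow_natCast, Real.rpow_def_of_pos hn0]
  refine Real.exp_le_exp.2 ?_
  push_cast
  have hy : 0 ≤ ((q : ℝ) + 2) * ((n : ℝ) ^ q * Real.log n) := by positivity
  nlinarith [Real.log_two_gt_d9]

theorem exists_forcesIndep_of_twr_le (q j : ℕ) :
    ∃ c : ℝ, 0 < c ∧ ∀ n : ℕ, 3 ≤ n → ∀ N : ℕ,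
      twr (j + 2) (c * ((n : ℝ) ^ q * Real.log n)) ≤ N →
        ∀ (α : Type*) [LinearOrder α], ForcesIndep α (j + 2) (q + 2 + j) n N := by
  induction j with
  | zero =>
    refine ⟨4 * (q + 2), by positivity, fun n hn N hN α _ => (forcesIndep_two α q n).mono ?_⟩
    exact_mod_cast (base_le_twr hn).trans hN
  | succ j ih =>
    obtain ⟨c, hc, h⟩ := ih
    obtain ⟨c', hc', h'⟩ := exists_twr_ge_pow j (q + 2 + j + 1) hc
    refine ⟨c', hc', fun n hn N hN α _ => ?_⟩
    have hlog := one_le_log_of_three_le hn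
    have hn1 : (1 : ℝ) ≤ n := by exact_mod_cast (by omega : 1 ≤ n)
    set x := (n : ℝ) ^ q * Real.log n with hx
    have hx1 : 1 ≤ x := one_le_mul_of_one_le_of_one_le (one_le_pow₀ hn1) hlog
    set y := twr (j + 2) (c * x) with hy
    have hypos : 0 < y := twr_pos _ (mul_pos hc (zero_lt_one.trans_le hx1))
    set m := ⌈y⌉₊ with hm
    have hm1 : 1 ≤ m := Nat.ceil_pos.2 hypos
    have hmy : (m : ℝ) ≤ y + 1 := (Nat.ceil_lt_add_one hypos.le).le
    refine ((h n hn m (Nat.le_ceil y) α).step (by omega)).mono ?_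
    have h1 : (2 * 2 ^ m ^ (q + 2 + j)) ^ m ≤ 2 ^ (2 * m ^ (q + 2 + j + 1)) := by
      rw [← pow_succ', ← pow_mul]
      refine Nat.pow_le_pow_right two_pos ?_
      rw [pow_succ]
      nlinarith [Nat.one_le_pow (q + 2 + j) m hm1]
    refine h1.trans ?_
    have h2 : ((2 * m ^ (q + 2 + j + 1) : ℕ) : ℝ) ≤ twr (j + 2) (c' * x) := by
      refine le_trans ?_ (h' x hx1)
      push_cast
      gcongr
    have h3 : ((2 ^ (2 * m ^ (q + 2 + j + 1)) : ℕ) : ℝ) ≤ N := by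
      refine le_trans ?_ hN
      rw [twr_add_two (j + 1)]
      rw [Nat.cast_pow, ← Real.rpow_natCast]
      exact Real.rpow_le_rpow_of_exponent_le one_le_two h2
    exact_mod_cast h3

theorem initialSparse_of_card_filter_le {α : Type*} [LinearOrder α] {k t : ℕ}
    {H : Finset (Finset α)}
    (hH : ∀ S : Finset α, S.card = k + 1 → (H.filter (· ⊆ S)).card ≤ t) (A : Finset α) :
    InitialSparse (· ∈ H) t k A := by
  classical
  intro S _ x _ hSx hSk hS
  have hxS : x ∉ S := fun h => lt_irrefl _ (hSx x h)
  refine Nat.le_trans ?_ (hH (insert x S) (by rw [Finset.card_insert_of_notMem hxS, hSk]))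
  set F := S.filter fun y => insert x (S.erase y) ∈ H with hF
  have hinj : Set.InjOn (fun y => insert x (S.erase y)) (F : Set α) := by
    intro y hy z hz hyz
    by_contra hne
    have hyS : y ∈ S := (Finset.mem_filter.1 hy).1
    have h1 : y ∈ insert x (S.erase z) :=
      Finset.mem_insert_of_mem (Finset.mem_erase.2 ⟨hne, hyS⟩)
    simp only at hyz
    rw [← hyz] at h1
    rcases Finset.mem_insert.1 h1 with rfl | h1
    · exact hxS hyS
    · exact Finset.ne_of_mem_erase h1 rfl
  have hSnot : S ∉ F.image fun y => insert x (S.erase y) := by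
    intro h
    obtain ⟨y, -, hy⟩ := Finset.mem_image.1 h
    exact hxS (hy ▸ Finset.mem_insert_self _ _)
  have hsub : insert S (F.image fun y => insert x (S.erase y)) ⊆ H.filter (· ⊆ insert x S) := by
    refine Finset.insert_subset (Finset.mem_filter.2 ⟨hS, Finset.subset_insert _ _⟩) ?_
    intro e he
    obtain ⟨y, hy, rfl⟩ := Finset.mem_image.1 he
    exact Finset.mem_filter.2 ⟨(Finset.mem_filter.1 hy).2,
      Finset.insert_subset_insert _ (Finset.erase_subset _ _)⟩
  have h1 := Finset.card_le_card hsub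
  rw [Finset.card_insert_of_notMem hSnot, Finset.card_image_of_injOn hinj] at h1
  convert h1

/-- If every `q + 2` vertices span at most one edge, an independent set can be grown greedily:
each `q`-subset of it excludes at most one further vertex. -/
theorem exists_indepIn_of_card_filter_le_one {α : Type*} [Fintype α] [DecidableEq α] {q n : ℕ}
    {H : Finset (Finset α)}
    (hH : ∀ S : Finset α, S.card = q + 2 → (H.filter (· ⊆ S)).card ≤ 1)
    (hcard : n + n ^ q ≤ Fintype.card α) :
    ∀ i ≤ n, ∃ I : Finset α, I.card = i ∧ IndepIn (· ∈ H) (q + 1) I := by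
  intro i
  induction i with
  | zero =>
    refine fun _ => ⟨∅, rfl, fun e he hc => ?_⟩
    rw [Finset.subset_empty.1 he] at hc
    simp at hc
  | succ i ih =>
    intro hi
    obtain ⟨I, hIi, hI⟩ := ih (by omega)
    let nb : Finset α → Finset α := fun S =>
      Finset.univ.filter fun v => v ∉ I ∧ insert v S ∈ H
    have hnb : ∀ S ∈ I.powersetCard q, (nb S).card ≤ 1 := by
      intro S hS
      obtain ⟨hSI, hSq⟩ := Finset.mem_powersetCard.1 hS
      refine Finset.card_le_one.2 fun a ha b hb => ?_
      obtain ⟨-, haI, haH⟩ := Finset.mem_filter.1 ha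
      obtain ⟨-, hbI, hbH⟩ := Finset.mem_filter.1 hb
      by_contra hab
      have haS : a ∉ S := fun h => haI (hSI h)
      have hbS : b ∉ insert a S := by
        simpa [Ne.symm hab] using fun h => hbI (hSI h)
      have h1 := hH (insert b (insert a S)) (by
        rw [Finset.card_insert_of_notMem hbS, Finset.card_insert_of_notMem haS, hSq])
      have h2 := Finset.card_le_one.1 h1 (insert a S)
        (Finset.mem_filter.2 ⟨haH, Finset.subset_insert _ _⟩) (insert b S)
        (Finset.mem_filter.2 ⟨hbH, Finset.insert_subset_insert _ (Finset.subset_insert _ _)⟩)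
      exact hbS (h2 ▸ Finset.mem_insert_self _ _)
    have hbad : (I ∪ (I.powersetCard q).biUnion nb).card < Fintype.card α := by
      refine (Finset.card_union_le _ _).trans_lt ?_
      have h1 := Finset.card_biUnion_le_card_mul _ _ 1 hnb
      rw [Finset.card_powersetCard, mul_one] at h1
      have h2 := (Nat.choose_le_pow I.card q).trans (Nat.pow_le_pow_left (by omega : I.card ≤ n) q)
      omega
    obtain ⟨v, hv⟩ : ∃ v, v ∉ I ∪ (I.powersetCard q).biUnion nb := by
      by_contra! hall
      rw [Finset.eq_univ_iff_forall.2 hall, Finset.card_univ] at hbad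
      exact lt_irrefl _ hbad
    rw [Finset.mem_union, not_or] at hv
    refine ⟨insert v I, by rw [Finset.card_insert_of_notMem hv.1, hIi], hI.insert ?_⟩
    intro S hS hSq hvS
    exact hv.2 (Finset.mem_biUnion.2 ⟨S, Finset.mem_powersetCard.2 ⟨hS, hSq⟩,
      Finset.mem_filter.2 ⟨Finset.mem_univ _, hv.1, hvS⟩⟩)

/-- For all integers `k ≥ 5` and `1 ≤ t ≤ k` there exists `c' > 0` such
that for every `n ≥ k`, every `k`-uniform hypergraph on at least
`twr t (c' * n ^ (k - t) * log n)` vertices in which every set of `k + 1` vertices induces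
at most `t` edges contains an independent set of size `n`. -/
theorem h_upper_bound (k t : ℕ) (hk : 5 ≤ k) (ht1 : 1 ≤ t) (htk : t ≤ k) :
    ∃ c' : ℝ, 0 < c' ∧ ∀ n : ℕ, k ≤ n →
      ∀ N : ℕ, (N : ℝ) ≥ twr t (c' * (n : ℝ) ^ (k - t) * Real.log n) →
        ∀ H : Finset (Finset (Fin N)),
          (∀ e ∈ H, e.card = k) →
          (∀ S : Finset (Fin N), S.card = k + 1 → (H.filter (· ⊆ S)).card ≤ t) →
          ∃ I : Finset (Fin N), I.card = n ∧ ∀ e ∈ H, ¬ e ⊆ I := by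
  rcases ht1.eq_or_lt with rfl | ht2
  · refine ⟨2, two_pos, fun n hn N hN H hcard hH => ?_⟩
    obtain ⟨q, rfl⟩ : ∃ q, k = q + 1 := ⟨k - 1, by omega⟩
    have hlog := one_le_log_of_three_le (by omega : 3 ≤ n)
    have hn1 : (1 : ℝ) ≤ n := by exact_mod_cast (by omega : 1 ≤ n)
    rw [twr_one, Nat.add_sub_cancel] at hN
    have h1 : (n : ℝ) ≤ (n : ℝ) ^ q := le_self_pow₀ hn1 (by omega)
    have h2 : ((n + n ^ q : ℕ) : ℝ) ≤ N := by
      push_cast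
      nlinarith
    obtain ⟨I, hIn, hI⟩ := exists_indepIn_of_card_filter_le_one (n := n) hH
      (by rw [Fintype.card_fin]; exact_mod_cast h2) n le_rfl
    exact ⟨I, hIn, fun e he heI => hI e heI (hcard e he) he⟩
  · obtain ⟨j, rfl⟩ : ∃ j, t = j + 2 := ⟨t - 2, by omega⟩
    obtain ⟨q, rfl⟩ : ∃ q, k = q + 2 + j := ⟨k - (j + 2), by omega⟩
    obtain ⟨c, hc, h⟩ := exists_forcesIndep_of_twr_le q j
    refine ⟨c, hc, fun n hn N hN H hcard hH => ?_⟩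
    rw [show q + 2 + j - (j + 2) = q by omega, mul_assoc] at hN
    obtain ⟨I, -, hIn, hI⟩ := h n (by omega) N hN (Fin N) (· ∈ H) Finset.univ (by simp)
      (initialSparse_of_card_filter_le hH _)
    exact ⟨I, hIn, fun e he heI => hI e heI (hcard e he) he⟩
end

section
/- Fix integers k ≥ 5 and N ≥ k, and let φ be any function from the (k−3)-element subsets of [N] = {1, …, N} to the 2-element subsets of [k−1]. Then for every k-element subset e of [N], the number of (k−1)-element subsets of e that belong to G_φ is at most 2, i.e. |G_φ[e]| ≤ 2. -/
/-- The (1-indexed) position of `u` in the increasing enumeration of the finite set `f`: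
if `f = {v_1 < v_2 < ⋯ < v_m}` and `u = v_i`, then `rankIn f u = i`. -/
def rankIn {N : ℕ} (f : Finset (Fin N)) (u : Fin N) : ℕ :=
  (f.filter (· ≤ u)).card

/-- The `(k-1)`-uniform hypergraph `G_φ` on `[N]`: a `(k-1)`-element set
`f = {v_1 < ⋯ < v_{k-1}}` is an edge iff `φ (f \ {v_i, v_j}) = {i, j}` for all `i < j`,
i.e. iff `φ (f \ {u, v}) = χ_f (f \ {u, v})` for every pair `{u, v} ⊆ f`. -/
def Gphi (k N : ℕ) (φ : Finset (Fin N) → Finset ℕ) : Finset (Finset (Fin N)) :=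
  (Finset.univ.powersetCard (k - 1)).filter
    (fun f => ∀ u ∈ f, ∀ v ∈ f, u ≠ v →
      φ (f \ {u, v}) = {rankIn f u, rankIn f v})

theorem rankIn_erase_add {N : ℕ} {e : Finset (Fin N)} {w : Fin N} (hw : w ∈ e) (x : Fin N) :
    rankIn (e.erase w) x + (if w ≤ x then 1 else 0) = rankIn e x := by
  unfold rankIn
  rw [Finset.filter_erase]
  split_ifs with h
  · exact Finset.card_erase_add_one (Finset.mem_filter.2 ⟨hw, h⟩)
  · rw [add_zero, Finset.erase_eq_of_notMem (s := e.filter (· ≤ x))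
      (fun hm => h (Finset.mem_filter.1 hm).2)]

theorem rankIn_lt_rankIn {N : ℕ} {e : Finset (Fin N)} {x y : Fin N} (hy : y ∈ e) (h : x < y) :
    rankIn e x < rankIn e y := by
  refine Finset.card_lt_card (Finset.ssubset_iff_of_subset ?_ |>.2 ⟨y, ?_, ?_⟩)
  · exact Finset.monotone_filter_right e (fun z _ hz => le_trans hz h.le)
  · simp [hy]
  · simp [h]

theorem pair_eq_pair_cases {x y z w : ℕ} (h : ({x, y} : Finset ℕ) = {z, w}) :
    (x = z ∧ y = w) ∨ (x = w ∧ y = z) := by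
  rw [← Finset.coe_inj] at h
  push_cast at h
  exact Set.pair_eq_pair_iff.1 h

/-- If two edges of `G_φ` arise from `e` by deleting `a < b`, then for any third element `c` of
`e` either `a` and `b` are consecutive in `e`, or `a, c, b` are. -/
theorem rankIn_eq_of_erase_mem_Gphi {k N : ℕ} {φ : Finset (Fin N) → Finset ℕ}
    {e : Finset (Fin N)} {a b c : Fin N} (ha : a ∈ e) (hb : b ∈ e) (hc : c ∈ e)
    (hab : a < b) (hca : c ≠ a) (hcb : c ≠ b)
    (hGa : e.erase a ∈ Gphi k N φ) (hGb : e.erase b ∈ Gphi k N φ) :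
    rankIn e b = rankIn e a + 1 ∨
      (rankIn e c = rankIn e a + 1 ∧ rankIn e b = rankIn e a + 2) := by
  have h1 := (Finset.mem_filter.1 hGa).2 b (by simp [hb, hab.ne']) c (by simp [hc, hca]) hcb.symm
  have h2 := (Finset.mem_filter.1 hGb).2 a (by simp [ha, hab.ne]) c (by simp [hc, hcb]) hca.symm
  have hs : e.erase a \ {b, c} = e.erase b \ {a, c} := by
    ext x
    simp only [Finset.mem_sdiff, Finset.mem_erase, Finset.mem_insert, Finset.mem_singleton]
    tauto
  rw [hs, h2] at h1
  have hp := pair_eq_pair_cases h1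
  have e1 := rankIn_erase_add ha b
  have e2 := rankIn_erase_add ha c
  have e3 := rankIn_erase_add hb a
  have e4 := rankIn_erase_add hb c
  rw [if_pos hab.le] at e1
  rw [if_neg hab.not_ge] at e3
  have hr := rankIn_lt_rankIn hb hab
  rcases lt_or_gt_of_ne hca with h | h
  · have := rankIn_lt_rankIn ha h
    rw [if_neg h.not_ge] at e2
    rw [if_neg (h.trans hab).not_ge] at e4
    omega
  · have := rankIn_lt_rankIn hc h
    rw [if_pos h.le] at e2
    rcases lt_or_gt_of_ne hcb with h' | h'
    · have := rankIn_lt_rankIn hb h'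
      rw [if_neg h'.not_ge] at e4
      omega
    · have := rankIn_lt_rankIn hc h'
      rw [if_pos h'.le] at e4
      omega

theorem rankIn_eq_add_one_of_erase_mem_Gphi {k N : ℕ} {φ : Finset (Fin N) → Finset ℕ}
    {e : Finset (Fin N)} (he : 4 ≤ e.card) {a b : Fin N} (ha : a ∈ e) (hb : b ∈ e)
    (hab : a < b) (hGa : e.erase a ∈ Gphi k N φ) (hGb : e.erase b ∈ Gphi k N φ) :
    rankIn e b = rankIn e a + 1 := by
  have hcard : 1 < (e \ {a, b}).card := by
    have h1 := Finset.le_card_sdiff {a, b} e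
    have h2 := Finset.card_le_two (a := a) (b := b)
    omega
  obtain ⟨c, hc, d, hd, hcd⟩ := Finset.one_lt_card.1 hcard
  simp only [Finset.mem_sdiff, Finset.mem_insert, Finset.mem_singleton, not_or] at hc hd
  have h1 := rankIn_eq_of_erase_mem_Gphi ha hb hc.1 hab hc.2.1 hc.2.2 hGa hGb
  have h2 := rankIn_eq_of_erase_mem_Gphi ha hb hd.1 hab hd.2.1 hd.2.2 hGa hGb
  rcases lt_or_gt_of_ne hcd with h | h
  · have := rankIn_lt_rankIn hd.1 h
    omega
  · have := rankIn_lt_rankIn hc.1 h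
    omega

/-- **Claim 2.** For `k ≥ 5`, `N ≥ k` and any `φ` from `(k-3)`-subsets of
`[N]` to `2`-element subsets of `[k-1]`, every `k`-element subset `e` of `[N]` contains at
most two edges of `G_φ`. -/
theorem Gphi_claim2 (k N : ℕ) (hk : 5 ≤ k) (hN : k ≤ N)
    (φ : Finset (Fin N) → Finset ℕ)
    (hφ : ∀ A : Finset (Fin N), A.card = k - 3 →
      (φ A).card = 2 ∧ φ A ⊆ Finset.Icc 1 (k - 1))
    (e : Finset (Fin N)) (he : e.card = k) :
    ((Gphi k N φ).filter (· ⊆ e)).card ≤ 2 := by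
  by_contra! hcon
  obtain ⟨f, g, h, hf, hg, hh, hfg, hfh, hgh⟩ := Finset.two_lt_card_iff.1 hcon
  have key : ∀ f ∈ (Gphi k N φ).filter (· ⊆ e),
      ∃ w ∈ e, f = e.erase w ∧ e.erase w ∈ Gphi k N φ := by
    intro f hf
    obtain ⟨hG, hfe⟩ := Finset.mem_filter.1 hf
    have hfc := (Finset.mem_powersetCard.1 (Finset.mem_filter.1 hG).1).2
    obtain ⟨w, hw, hwf⟩ := Finset.exists_mem_notMem_of_card_lt_card (s := f) (t := e) (by omega)
    have hfw : f = e.erase w := by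
      refine Finset.eq_of_subset_of_card_le (Finset.subset_erase.2 ⟨hfe, hwf⟩) ?_
      rw [Finset.card_erase_of_mem hw]
      omega
    exact ⟨w, hw, hfw, hfw ▸ hG⟩
  obtain ⟨a, ha, rfl, hGa⟩ := key f hf
  obtain ⟨b, hb, rfl, hGb⟩ := key g hg
  obtain ⟨c, hc, rfl, hGc⟩ := key h hh
  have consec : ∀ x ∈ e, ∀ y ∈ e, e.erase x ∈ Gphi k N φ → e.erase y ∈ Gphi k N φ →
      e.erase x ≠ e.erase y → rankIn e y = rankIn e x + 1 ∨ rankIn e x = rankIn e y + 1 := by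
    intro x hx y hy hGx hGy hne
    have hxy : x ≠ y := fun h => hne (h ▸ rfl)
    rcases lt_or_gt_of_ne hxy with h | h
    · exact Or.inl (rankIn_eq_add_one_of_erase_mem_Gphi (by omega) hx hy h hGx hGy)
    · exact Or.inr (rankIn_eq_add_one_of_erase_mem_Gphi (by omega) hy hx h hGy hGx)
  have h1 := consec a ha b hb hGa hGb hfg
  have h2 := consec a ha c hc hGa hGc hfh
  have h3 := consec b hb c hc hGb hGc hgh
  omega
end

section
/- Fix integers k ≥ 5 and N ≥ k+1, and let φ be any function from the (k−3)-element subsets of [N] = {1, …, N} to the 2-element subsets of [k−1]. Then there is no (k+1)-element subset S of [N] together with three pairwise disjoint 2-element subsets p_1, p_2, p_3 of S such that S \ p_1, S \ p_2, and S \ p_3 are all edges of G_φ. In other words, G_φ contains no copy of the (k−1)-uniform hypergraph T_3. -/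
theorem Finset.exists_lt_of_card_eq_two {α : Type*} [LinearOrder α] {p : Finset α}
    (h : p.card = 2) : ∃ a b, a < b ∧ p = {a, b} := by
  obtain ⟨a, b, hab, rfl⟩ := Finset.card_eq_two.mp h
  rcases lt_or_gt_of_ne hab with h | h
  · exact ⟨a, b, h, rfl⟩
  · exact ⟨b, a, h, Finset.pair_comm a b⟩

theorem rankIn_lt_rankIn_s5 {N : ℕ} {f : Finset (Fin N)} {u v : Fin N} (hv : v ∈ f) (huv : u < v) :
    rankIn f u < rankIn f v := by
  refine Finset.card_lt_card (Finset.ssubset_iff_of_subset ?_ |>.mpr ⟨v, ?_, ?_⟩)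
  · exact Finset.monotone_filter_right f fun x _ hx => le_trans hx huv.le
  · simp [hv]
  · simp [huv]

theorem eq_of_pair_eq_pair_of_lt {α : Type*} [LinearOrder α] {a b c d : α}
    (hab : a < b) (hcd : c < d) (h : ({a, b} : Finset α) = {c, d}) : a = c := by
  have h' : ({a, b} : Set α) = {c, d} := by
    simpa only [Finset.coe_pair] using congrArg (fun s : Finset α => (s : Set α)) h
  rcases Set.pair_eq_pair_iff.mp h' with ⟨h1, -⟩ | ⟨rfl, rfl⟩
  · exact h1
  · exact absurd hab hcd.not_gt

theorem rankIn_eq_rankIn_of_mem_Gphi {k N : ℕ} {φ : Finset (Fin N) → Finset ℕ}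
    {S : Finset (Fin N)} {a b c d : Fin N} (hab : a < b) (hcd : c < d)
    (hS : {a, b} ⊆ S) (hS' : {c, d} ⊆ S) (hdisj : Disjoint ({a, b} : Finset (Fin N)) {c, d})
    (h : S \ {a, b} ∈ Gphi k N φ) (h' : S \ {c, d} ∈ Gphi k N φ) :
    rankIn (S \ {a, b}) c = rankIn (S \ {c, d}) a := by
  have hsub : {c, d} ⊆ S \ {a, b} := Finset.subset_sdiff.mpr ⟨hS', hdisj.symm⟩
  have hsub' : {a, b} ⊆ S \ {c, d} := Finset.subset_sdiff.mpr ⟨hS, hdisj⟩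
  simp only [Finset.insert_subset_iff, Finset.singleton_subset_iff] at hsub hsub'
  refine eq_of_pair_eq_pair_of_lt (rankIn_lt_rankIn_s5 hsub.2 hcd) (rankIn_lt_rankIn_s5 hsub'.2 hab) ?_
  rw [← (Finset.mem_filter.mp h).2 c hsub.1 d hsub.2 hcd.ne,
    ← (Finset.mem_filter.mp h').2 a hsub'.1 b hsub'.2 hab.ne, sdiff_right_comm]

/-- If two edges of `G_φ` inside `S` omit disjoint pairs with minima `a < c`, then the only element
of `S` that can lie strictly between `a` and `c` is the partner of `a`. -/
theorem eq_of_between_of_mem_Gphi {k N : ℕ} {φ : Finset (Fin N) → Finset ℕ}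
    {S : Finset (Fin N)} {a b c d e : Fin N} (hab : a < b) (hcd : c < d)
    (hS : {a, b} ⊆ S) (hS' : {c, d} ⊆ S) (hdisj : Disjoint ({a, b} : Finset (Fin N)) {c, d})
    (h : S \ {a, b} ∈ Gphi k N φ) (h' : S \ {c, d} ∈ Gphi k N φ)
    (he : e ∈ S) (hae : a < e) (hec : e < c) : e = b := by
  by_contra heb
  have hrank := rankIn_eq_rankIn_of_mem_Gphi hab hcd hS hS' hdisj h h'
  have hcb : c ≠ b := by rintro rfl; simp at hdisj
  simp only [Finset.insert_subset_iff, Finset.singleton_subset_iff] at hS hS'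
  have hupper : rankIn (S \ {c, d}) a ≤ (S.filter (· ≤ a)).card :=
    Finset.card_le_card (Finset.filter_subset_filter _ Finset.sdiff_subset)
  have hlower : insert c (insert e ((S.filter (· ≤ a)).erase a)) ⊆
      (S \ {a, b}).filter (· ≤ c) := by
    intro x hx
    simp only [Finset.mem_insert, Finset.mem_erase, Finset.mem_filter, Finset.mem_sdiff,
      Finset.mem_singleton] at hx ⊢
    grind
  have hcard := Finset.card_le_card hlower
  rw [Finset.card_insert_of_notMem (by simp; grind), Finset.card_insert_of_notMem (by simp; grind),
    Finset.card_erase_add_one (by simp [hS.1])] at hcard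
  unfold rankIn at *
  omega


/-- **Claim 3.** For `k ≥ 5`, `N ≥ k + 1` and any `φ` from `(k-3)`-subsets
of `[N]` to `2`-element subsets of `[k-1]`, there is no `(k+1)`-element subset `S` of `[N]`
with three pairwise disjoint `2`-element subsets `p₁, p₂, p₃` of `S` such that
`S \ p₁`, `S \ p₂`, `S \ p₃` are all edges of `G_φ`; that is, `T₃ ⊄ G_φ`. -/
theorem Gphi_claim3 (k N : ℕ) (hk : 5 ≤ k) (hN : k + 1 ≤ N)
    (φ : Finset (Fin N) → Finset ℕ)
    (hφ : ∀ A : Finset (Fin N), A.card = k - 3 →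
      (φ A).card = 2 ∧ φ A ⊆ Finset.Icc 1 (k - 1)) :
    ¬ ∃ (S p₁ p₂ p₃ : Finset (Fin N)),
        S.card = k + 1 ∧
        p₁.card = 2 ∧ p₂.card = 2 ∧ p₃.card = 2 ∧
        p₁ ⊆ S ∧ p₂ ⊆ S ∧ p₃ ⊆ S ∧
        Disjoint p₁ p₂ ∧ Disjoint p₁ p₃ ∧ Disjoint p₂ p₃ ∧
        S \ p₁ ∈ Gphi k N φ ∧ S \ p₂ ∈ Gphi k N φ ∧ S \ p₃ ∈ Gphi k N φ := by
  rintro ⟨S, p₁, p₂, p₃, -, h₁, h₂, h₃, hS₁, hS₂, hS₃, h₁₂, h₁₃, h₂₃, hG₁, hG₂, hG₃⟩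
  obtain ⟨a₁, b₁, hab₁, rfl⟩ := Finset.exists_lt_of_card_eq_two h₁
  obtain ⟨a₂, b₂, hab₂, rfl⟩ := Finset.exists_lt_of_card_eq_two h₂
  obtain ⟨a₃, b₃, hab₃, rfl⟩ := Finset.exists_lt_of_card_eq_two h₃
  have ha₁ : a₁ ∈ S := hS₁ (by simp)
  have ha₂ : a₂ ∈ S := hS₂ (by simp)
  have ha₃ : a₃ ∈ S := hS₃ (by simp)
  have k₁₂ := eq_of_between_of_mem_Gphi hab₁ hab₂ hS₁ hS₂ h₁₂ hG₁ hG₂ ha₃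
  have k₂₁ := eq_of_between_of_mem_Gphi hab₂ hab₁ hS₂ hS₁ h₁₂.symm hG₂ hG₁ ha₃
  have k₁₃ := eq_of_between_of_mem_Gphi hab₁ hab₃ hS₁ hS₃ h₁₃ hG₁ hG₃ ha₂
  have k₃₁ := eq_of_between_of_mem_Gphi hab₃ hab₁ hS₃ hS₁ h₁₃.symm hG₃ hG₁ ha₂
  have k₂₃ := eq_of_between_of_mem_Gphi hab₂ hab₃ hS₂ hS₃ h₂₃ hG₂ hG₃ ha₁
  have k₃₂ := eq_of_between_of_mem_Gphi hab₃ hab₂ hS₃ hS₂ h₂₃.symm hG₃ hG₂ ha₁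
  simp only [Finset.disjoint_insert_left, Finset.disjoint_singleton_left, Finset.mem_insert,
    Finset.mem_singleton, not_or] at h₁₂ h₁₃ h₂₃
  grind
end

section
/- Let k ≥ 5 be an integer, let S be a set of k+1 vertices, and let G be a (k−1)-uniform hypergraph on S such that (i) every k-element subset e of S contains at most 2 edges of G, and (ii) there do not exist three pairwise disjoint 2-element subsets p_1, p_2, p_3 of S with S \ p_1, S \ p_2, S \ p_3 all edges of G. Then the number of k-element subsets e of S for which |G[e]| is odd is exactly 0, 2, or 4. -/
/-- In a family of pairs with all degrees at most two, an edge `e` with an endpoint of degree one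
meets edges through at most two vertices of degree one. -/
theorem card_leaves_near_edge_le_two {V : Type*} [DecidableEq V] (S : Finset V)
    (E : Finset (Finset V)) (hE : ∀ p ∈ E, p.card = 2)
    (hd : ∀ v, (E.filter (v ∈ ·)).card ≤ 2) {e : Finset V} (he : e ∈ E) {a : V} (hae : a ∈ e)
    (ha : (E.filter (a ∈ ·)).card = 1) :
    (S.filter fun v => (E.filter (v ∈ ·)).card = 1 ∧
      ∃ f ∈ E, v ∈ f ∧ ¬ Disjoint f e).card ≤ 2 := by
  obtain ⟨b, hab, rfl⟩ : ∃ b, a ≠ b ∧ e = {a, b} := by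
    obtain ⟨x, y, hxy, rfl⟩ := Finset.card_eq_two.1 (hE e he)
    rcases Finset.mem_insert.1 hae with rfl | h
    · exact ⟨y, hxy, rfl⟩
    · rw [Finset.mem_singleton] at h
      subst h
      exact ⟨x, hxy.symm, Finset.pair_comm _ _⟩
  have ha' : ∀ f ∈ E, a ∈ f → f = {a, b} := fun f hf haf =>
    Finset.card_le_one.1 ha.le f (by simp [hf, haf]) _ (by simp [he])
  by_cases hb : ∀ f ∈ E, b ∈ f → f = {a, b}
  · refine (Finset.card_le_card (t := {a, b}) ?_).trans Finset.card_le_two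
    intro v hv
    obtain ⟨-, -, f, hf, hvf, hfe⟩ := Finset.mem_filter.1 hv
    obtain ⟨x, hxf, hxe⟩ := Finset.not_disjoint_iff.1 hfe
    rcases Finset.mem_insert.1 hxe with rfl | h
    · exact ha' f hf hxf ▸ hvf
    · rw [Finset.mem_singleton] at h
      subst h
      exact hb f hf hxf ▸ hvf
  · push Not at hb
    obtain ⟨f, hf, hbf, hfe⟩ := hb
    have hsub : ({{a, b}, f} : Finset (Finset V)) ⊆ E.filter (b ∈ ·) := by
      intro x hx
      rcases Finset.mem_insert.1 hx with rfl | h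
      · simp [he]
      · rw [Finset.mem_singleton] at h
        subst h
        simp [hf, hbf]
    have hcard : ({{a, b}, f} : Finset (Finset V)).card = 2 := Finset.card_pair (Ne.symm hfe)
    have heq := Finset.eq_of_subset_of_card_le hsub (by rw [hcard]; exact hd b)
    have hb1 : (E.filter (b ∈ ·)).card = 2 := by rw [← heq, hcard]
    have hcf : (f.erase b).card = 1 := by rw [Finset.card_erase_of_mem hbf, hE f hf]
    obtain ⟨c, hc⟩ := Finset.card_eq_one.1 hcf
    refine (Finset.card_le_card (t := {a, c}) ?_).trans Finset.card_le_two
    intro v hv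
    obtain ⟨-, hv1, g, hg, hvg, hge⟩ := Finset.mem_filter.1 hv
    have hvb : v ≠ b := by
      rintro rfl
      omega
    have hgf : g = {a, b} ∨ g = f := by
      obtain ⟨x, hxg, hxe⟩ := Finset.not_disjoint_iff.1 hge
      rcases Finset.mem_insert.1 hxe with rfl | h
      · exact Or.inl (ha' g hg hxg)
      · rw [Finset.mem_singleton] at h
        subst h
        have : g ∈ E.filter (x ∈ ·) := by simp [hg, hxg]
        rw [← heq] at this
        simpa using this
    rcases hgf with rfl | rfl
    · have : v = a := by simpa [hvb] using hvg
      simp [this]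
    · have : v ∈ g.erase b := Finset.mem_erase.2 ⟨hvb, hvg⟩
      rw [hc, Finset.mem_singleton] at this
      simp [this]

/-- A family of pairs with all degrees at most two and more than four vertices of degree one
contains three pairwise disjoint pairs. -/
theorem exists_three_disjoint_of_four_lt_card_leaves {V : Type*} [DecidableEq V] (S : Finset V)
    (E : Finset (Finset V)) (hE : ∀ p ∈ E, p.card = 2)
    (hd : ∀ v, (E.filter (v ∈ ·)).card ≤ 2)
    (hL : 4 < (S.filter fun v => (E.filter (v ∈ ·)).card = 1).card) :
    ∃ p₁ ∈ E, ∃ p₂ ∈ E, ∃ p₃ ∈ E, Disjoint p₁ p₂ ∧ Disjoint p₁ p₃ ∧ Disjoint p₂ p₃ := by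
  set L := S.filter fun v => (E.filter (v ∈ ·)).card = 1
  let K : Finset V → Finset V := fun e => S.filter fun v => (E.filter (v ∈ ·)).card = 1 ∧
      ∃ f ∈ E, v ∈ f ∧ ¬ Disjoint f e
  have hK : ∀ a ∈ L, ∀ e ∈ E, a ∈ e → (K e).card ≤ 2 := fun a haL e he hae =>
    card_leaves_near_edge_le_two S E hE hd he hae (Finset.mem_filter.1 haL).2
  have hedge : ∀ a ∈ L, ∃ e ∈ E, a ∈ e := by
    intro a haL
    obtain ⟨e, he⟩ := Finset.card_pos.1 (by rw [(Finset.mem_filter.1 haL).2]; exact one_pos)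
    exact ⟨e, (Finset.mem_filter.1 he).1, (Finset.mem_filter.1 he).2⟩
  have hdisj : ∀ a ∈ L, ∀ e, a ∉ K e → ∀ f ∈ E, a ∈ f → Disjoint e f := by
    intro a haL e hae f hf haf
    by_contra h
    obtain ⟨haS, ha1⟩ := Finset.mem_filter.1 haL
    exact hae (Finset.mem_filter.2 ⟨haS, ha1, f, hf, haf, fun h' => h h'.symm⟩)
  obtain ⟨a₁, ha₁⟩ := Finset.card_pos.1 (by omega : 0 < L.card)
  obtain ⟨p₁, hp₁, hap₁⟩ := hedge a₁ ha₁
  have hK₁ := hK a₁ ha₁ p₁ hp₁ hap₁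
  obtain ⟨a₂, ha₂, hna₂⟩ := Finset.exists_mem_notMem_of_card_lt_card (by omega :
    (K p₁).card < L.card)
  obtain ⟨p₂, hp₂, hap₂⟩ := hedge a₂ ha₂
  have hK₂ := hK a₂ ha₂ p₂ hp₂ hap₂
  have hunion := Finset.card_union_le (K p₁) (K p₂)
  obtain ⟨a₃, ha₃, hna₃⟩ := Finset.exists_mem_notMem_of_card_lt_card (by omega :
    (K p₁ ∪ K p₂).card < L.card)
  obtain ⟨p₃, hp₃, hap₃⟩ := hedge a₃ ha₃
  rw [Finset.notMem_union] at hna₃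
  exact ⟨p₁, hp₁, p₂, hp₂, p₃, hp₃, hdisj a₂ ha₂ _ hna₂ _ hp₂ hap₂,
    hdisj a₃ ha₃ _ hna₃.1 _ hp₃ hap₃, hdisj a₃ ha₃ _ hna₃.2 _ hp₃ hap₃⟩

/-- Handshake lemma for a family of pairs. -/
theorem even_card_odd_degree_of_pairs {V : Type*} [DecidableEq V] (S : Finset V)
    (E : Finset (Finset V)) (hE : ∀ p ∈ E, p ⊆ S ∧ p.card = 2) :
    Even (S.filter fun v => Odd (E.filter (v ∈ ·)).card).card := by
  rw [← Finset.even_sum_iff_even_card_odd]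
  have hsum : ∑ v ∈ S, (E.filter (v ∈ ·)).card = ∑ p ∈ E, (S.filter (· ∈ p)).card :=
    Finset.sum_card_bipartiteAbove_eq_sum_card_bipartiteBelow _
  rw [hsum]
  refine Finset.even_sum _ fun p hp => ?_
  rw [Finset.filter_mem_eq_inter, Finset.inter_eq_right.2 (hE p hp).1, (hE p hp).2]
  exact even_two


/-- Let `k ≥ 5`, let `S` be a set of `k + 1` vertices, and let `G` be a
`(k-1)`-uniform hypergraph on `S` such that (i) every `k`-element subset of `S` contains
at most 2 edges of `G`, and (ii) there are no three pairwise disjoint pairs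
`p₁, p₂, p₃ ⊆ S` with `S \ p₁`, `S \ p₂`, `S \ p₃` all edges of `G`. Then the number of
`k`-element subsets `e` of `S` with `|G[e]|` odd is exactly 0, 2, or 4. -/
theorem odd_links_024 {V : Type*} [DecidableEq V] (k : ℕ) (hk : 5 ≤ k)
    (S : Finset V) (hS : S.card = k + 1)
    (G : Finset (Finset V)) (hG : ∀ f ∈ G, f ⊆ S ∧ f.card = k - 1)
    (h2 : ∀ e : Finset V, e ⊆ S → e.card = k → (G.filter (· ⊆ e)).card ≤ 2)
    (hT3 : ¬ ∃ p₁ p₂ p₃ : Finset V,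
        p₁.card = 2 ∧ p₂.card = 2 ∧ p₃.card = 2 ∧
        p₁ ⊆ S ∧ p₂ ⊆ S ∧ p₃ ⊆ S ∧
        Disjoint p₁ p₂ ∧ Disjoint p₁ p₃ ∧ Disjoint p₂ p₃ ∧
        S \ p₁ ∈ G ∧ S \ p₂ ∈ G ∧ S \ p₃ ∈ G) :
    ((S.powersetCard k).filter (fun e => Odd ((G.filter (· ⊆ e)).card))).card
      ∈ ({0, 2, 4} : Set ℕ) := by

  set E : Finset (Finset V) := G.image (S \ ·)
  have hE : ∀ p ∈ E, p ⊆ S ∧ p.card = 2 ∧ S \ p ∈ G := by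
    intro p hp
    obtain ⟨f, hf, rfl⟩ := Finset.mem_image.1 hp
    obtain ⟨hfS, hfc⟩ := hG f hf
    refine ⟨Finset.sdiff_subset, ?_, ?_⟩
    · rw [Finset.card_sdiff_of_subset hfS]
      omega
    · rwa [Finset.sdiff_sdiff_eq_self hfS]
  have hdeg : ∀ v ∈ S, (G.filter (· ⊆ S.erase v)).card = (E.filter (v ∈ ·)).card := by
    intro v hv
    refine Finset.card_bij (fun f _ => S \ f) ?_ ?_ ?_
    · intro f hf
      obtain ⟨hfG, hfv⟩ := Finset.mem_filter.1 hf
      exact Finset.mem_filter.2 ⟨Finset.mem_image_of_mem _ hfG,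
        Finset.mem_sdiff.2 ⟨hv, fun h => Finset.notMem_erase v S (hfv h)⟩⟩
    · intro f hf g hg hfg
      rw [← Finset.sdiff_sdiff_eq_self (hG f (Finset.mem_filter.1 hf).1).1, hfg,
        Finset.sdiff_sdiff_eq_self (hG g (Finset.mem_filter.1 hg).1).1]
    · intro p hp
      obtain ⟨hpE, hvp⟩ := Finset.mem_filter.1 hp
      obtain ⟨hpS, -, hpG⟩ := hE p hpE
      refine ⟨S \ p, Finset.mem_filter.2 ⟨hpG, ?_⟩, Finset.sdiff_sdiff_eq_self hpS⟩
      exact Finset.subset_erase.2 ⟨Finset.sdiff_subset, fun h => (Finset.mem_sdiff.1 h).2 hvp⟩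
  have hd : ∀ v, (E.filter (v ∈ ·)).card ≤ 2 := by
    intro v
    by_cases hv : v ∈ S
    · rw [← hdeg v hv]
      exact h2 _ (Finset.erase_subset _ _) (by rw [Finset.card_erase_of_mem hv]; omega)
    · rw [Finset.filter_eq_empty_iff.2 fun p hp hvp => hv ((hE p hp).1 hvp)]
      simp
  have hcount : ((S.powersetCard k).filter (fun e => Odd ((G.filter (· ⊆ e)).card))).card =
      (S.filter fun v => Odd (E.filter (v ∈ ·)).card).card := by
    symm
    refine Finset.card_bij (fun v _ => S.erase v) ?_ ?_ ?_
    · intro v hv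
      obtain ⟨hvS, hvo⟩ := Finset.mem_filter.1 hv
      refine Finset.mem_filter.2 ⟨Finset.mem_powersetCard.2 ⟨Finset.erase_subset _ _, ?_⟩, ?_⟩
      · rw [Finset.card_erase_of_mem hvS]
        omega
      · rwa [hdeg v hvS]
    · intro v hv w hw hvw
      exact Finset.erase_injOn S (Finset.mem_filter.1 hv).1 (Finset.mem_filter.1 hw).1 hvw
    · intro e he
      obtain ⟨he', heo⟩ := Finset.mem_filter.1 he
      obtain ⟨heS, hec⟩ := Finset.mem_powersetCard.1 he'
      obtain ⟨v, hv⟩ := Finset.card_eq_one.1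
        (show (S \ e).card = 1 by rw [Finset.card_sdiff_of_subset heS]; omega)
      have hvS : v ∈ S := (Finset.mem_sdiff.1 (hv ▸ Finset.mem_singleton_self v)).1
      have hev : S.erase v = e := by
        rw [← Finset.sdiff_singleton_eq_erase, ← hv, Finset.sdiff_sdiff_eq_self heS]
      refine ⟨v, Finset.mem_filter.2 ⟨hvS, ?_⟩, hev⟩
      rw [← hdeg v hvS, hev]
      exact heo
  have hodd : (S.filter fun v => Odd (E.filter (v ∈ ·)).card) =
      S.filter fun v => (E.filter (v ∈ ·)).card = 1 := by
    refine Finset.filter_congr fun v _ => ⟨fun ⟨m, hm⟩ => ?_, fun h => h ▸ odd_one⟩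
    have := hd v
    omega
  have hle : (S.filter fun v => Odd (E.filter (v ∈ ·)).card).card ≤ 4 := by
    by_contra! hlt
    rw [hodd] at hlt
    obtain ⟨p₁, h₁, p₂, h₂, p₃, h₃, h₁₂, h₁₃, h₂₃⟩ :=
      exists_three_disjoint_of_four_lt_card_leaves S E (fun p hp => (hE p hp).2.1) hd hlt
    obtain ⟨hs₁, hc₁, hg₁⟩ := hE p₁ h₁
    obtain ⟨hs₂, hc₂, hg₂⟩ := hE p₂ h₂
    obtain ⟨hs₃, hc₃, hg₃⟩ := hE p₃ h₃
    exact hT3 ⟨p₁, p₂, p₃, hc₁, hc₂, hc₃, hs₁, hs₂, hs₃, h₁₂, h₁₃, h₂₃, hg₁, hg₂, hg₃⟩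
  obtain ⟨m, hm⟩ := even_card_odd_degree_of_pairs S E fun p hp => ⟨(hE p hp).1, (hE p hp).2.1⟩
  rw [hcount]
  simp only [Set.mem_insert_iff, Set.mem_singleton_iff]
  omega
end

section
/- Let d ≥ 2 be an integer and let P be a set of d+3 points in ℝ^d in general position (i.e., every (d+1)-element subset of P is affinely independent). Then the number of (d+2)-element subsets of P that are not in convex position is exactly 0, 2, or 4. -/
open scoped Classical

/-- The affine dependencies among the points of a finite set `P`: coefficient functions with total
weight zero and zero weighted vector sum over `P`. -/
def affineDependencies {E : Type*} [AddCommGroup E] [Module ℝ E] (P : Finset E) :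
    Submodule ℝ (E → ℝ) where
  carrier := {c | ∑ x ∈ P, c x = 0 ∧ ∑ x ∈ P, c x • x = 0}
  add_mem' := by
    rintro a b ⟨ha, ha'⟩ ⟨hb, hb'⟩
    simp [add_smul, Finset.sum_add_distrib, ha, ha', hb, hb']
  zero_mem' := by simp
  smul_mem' := by
    rintro t a ⟨ha, ha'⟩
    simp [mul_smul, ← Finset.mul_sum, ← Finset.smul_sum, ha, ha']

section Combinatorics

variable {α : Type*}

/-- `c` is `-1` at `p` and nonnegative at the other points of `P`; for an affine dependency `c`
this expresses `p` as a convex combination of the other points. -/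
def IsRepresentation (P : Finset α) (p : α) (c : α → ℝ) : Prop :=
  c p = -1 ∧ ∀ r ∈ P, r ≠ p → 0 ≤ c r

/-- The points of `P` other than `p` that can be omitted from a representation of `p` by some
`c ∈ W`. -/
noncomputable def omissible (W : Submodule ℝ (α → ℝ)) (P : Finset α) (p : α) : Finset α :=
  P.filter fun q => q ≠ p ∧ ∃ c ∈ W, IsRepresentation P p c ∧ c q = 0

variable {W : Submodule ℝ (α → ℝ)} {P : Finset α}

lemma mem_omissible {p q : α} : q ∈ omissible W P p ↔
    q ∈ P ∧ q ≠ p ∧ ∃ c ∈ W, IsRepresentation P p c ∧ c q = 0 := by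
  simp [omissible]

lemma IsRepresentation.pos {p q r : α} {c : α → ℝ} (hc : IsRepresentation P p c)
    (hG : ∀ c ∈ W, ∀ a ∈ P, ∀ b ∈ P, a ≠ b → c a = 0 → c b = 0 → ∀ x ∈ P, c x = 0)
    (hcW : c ∈ W) (hp : p ∈ P) (hq : q ∈ P) (hcq : c q = 0) (hr : r ∈ P) (hrp : r ≠ p)
    (hrq : r ≠ q) : 0 < c r := by
  refine lt_of_le_of_ne (hc.2 r hr hrp) fun h => ?_
  have := hG c hcW r hr q hq hrq h.symm hcq p hp
  linarith [hc.1]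

lemma eq_of_mem_omissible {p p' q : α} (hP : 4 ≤ P.card)
    (hG : ∀ c ∈ W, ∀ a ∈ P, ∀ b ∈ P, a ≠ b → c a = 0 → c b = 0 → ∀ x ∈ P, c x = 0)
    (hp : p ∈ P) (hp' : p' ∈ P) (h : q ∈ omissible W P p) (h' : q ∈ omissible W P p') :
    p = p' := by
  by_contra hne
  obtain ⟨hq, hqp, c, hcW, hc, hcq⟩ := mem_omissible.1 h
  obtain ⟨-, hqp', c', hcW', hc', hcq'⟩ := mem_omissible.1 h'
  obtain ⟨r, hr, hrn⟩ : ∃ r ∈ P, r ∉ ({p, p', q} : Finset α) :=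
    Finset.exists_mem_notMem_of_card_lt_card (lt_of_le_of_lt Finset.card_le_three (by omega))
  simp only [Finset.mem_insert, Finset.mem_singleton, not_or] at hrn
  have h1 := hc'.pos hG hcW' hp' hq hcq' hp hne (Ne.symm hqp)
  have h2 := hc'.pos hG hcW' hp' hq hcq' hr hrn.2.1 hrn.2.2
  have h3 := hc.pos hG hcW hp hq hcq hr hrn.1 hrn.2.2
  have h4 := hG (c' + c' p • c) (W.add_mem hcW' (W.smul_mem _ hcW)) p hp q hq (Ne.symm hqp)
    (by simp [hc.1]) (by simp [hcq, hcq']) r hr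
  simp only [Pi.add_apply, Pi.smul_apply, smul_eq_mul] at h4
  have := mul_pos h1 h3
  linarith

lemma mem_omissible_of_isRepresentation {p₁ p₂ : α} {c₁ c₂ : α → ℝ} (hP : 4 ≤ P.card)
    (hsum : ∀ c ∈ W, ∑ x ∈ P, c x = 0)
    (hG : ∀ c ∈ W, ∀ a ∈ P, ∀ b ∈ P, a ≠ b → c a = 0 → c b = 0 → ∀ x ∈ P, c x = 0)
    (hp₁ : p₁ ∈ P) (hp₂ : p₂ ∈ P) (hne : p₁ ≠ p₂) (hW₁ : c₁ ∈ W) (hW₂ : c₂ ∈ W)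
    (h₁ : IsRepresentation P p₁ c₁) (h₂ : IsRepresentation P p₂ c₂) :
    p₁ ∈ omissible W P p₂ := by
  set b : α → ℝ := c₂ + c₂ p₁ • c₁ with hb
  have hbW : b ∈ W := W.add_mem hW₂ (W.smul_mem _ hW₁)
  have hbv : ∀ x, b x = c₂ x + c₂ p₁ * c₁ x := fun x => by simp [hb]
  have hk : 0 ≤ c₂ p₁ := h₂.2 _ hp₁ hne
  have hb1 : b p₁ = 0 := by rw [hbv, h₁.1]; ring
  have hbn : ∀ r ∈ P, r ≠ p₂ → 0 ≤ b r := by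
    intro r hr hr2
    by_cases hr1 : r = p₁
    · rw [hr1, hb1]
    · rw [hbv]
      exact add_nonneg (h₂.2 r hr hr2) (mul_nonneg hk (h₁.2 r hr hr1))
  have hb2 : b p₂ < 0 := by
    by_contra! hge
    have hall : ∀ r ∈ P, b r = 0 := by
      refine (Finset.sum_eq_zero_iff_of_nonneg fun r hr => ?_).1 (hsum b hbW)
      by_cases hr2 : r = p₂
      · rwa [hr2]
      · exact hbn r hr hr2
    have hz : ∀ r ∈ P, r ≠ p₁ → r ≠ p₂ → c₂ r = 0 := by
      intro r hr hr1 hr2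
      have := hall r hr
      rw [hbv] at this
      have := mul_nonneg hk (h₁.2 r hr hr1)
      linarith [h₂.2 r hr hr2]
    have hcard : 1 < ((P.erase p₁).erase p₂).card := by
      rw [Finset.card_erase_of_mem (by simp [hp₂, hne.symm]), Finset.card_erase_of_mem hp₁]
      omega
    obtain ⟨u, hu, v, hv, huv⟩ := Finset.one_lt_card.1 hcard
    simp only [Finset.mem_erase] at hu hv
    have := hG c₂ hW₂ u hu.2.2 v hv.2.2 huv (hz u hu.2.2 hu.2.1 hu.1)
      (hz v hv.2.2 hv.2.1 hv.1) p₂ hp₂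
    linarith [h₂.1]
  refine mem_omissible.2 ⟨hp₁, hne, (-(b p₂))⁻¹ • b, W.smul_mem _ hbW, ⟨?_, ?_⟩, by simp [hb1]⟩
  · have := hb2.ne
    simp only [Pi.smul_apply, smul_eq_mul]
    field_simp
  · intro r hr hr2
    exact mul_nonneg (inv_nonneg.2 (by linarith)) (hbn r hr hr2)

lemma card_omissible_of_mem {p q : α}
    (hsum : ∀ c ∈ W, ∑ x ∈ P, c x = 0)
    (hG : ∀ c ∈ W, ∀ a ∈ P, ∀ b ∈ P, a ≠ b → c a = 0 → c b = 0 → ∀ x ∈ P, c x = 0)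
    (hex : ∀ p ∈ P, ∃ e ∈ W, e p = 0 ∧ ∃ x ∈ P, e x ≠ 0)
    (hp : p ∈ P) (hmem : q ∈ omissible W P p) : (omissible W P p).card = 2 := by
  obtain ⟨hq, hqp, c, hcW, hc, hcq⟩ := mem_omissible.1 hmem
  obtain ⟨e, heW, hep, heq⟩ : ∃ e ∈ W, e p = 0 ∧ 0 < e q := by
    obtain ⟨e, heW, hep, x, hx, hex⟩ := hex p hp
    have h0 : e q ≠ 0 := fun h => hex (hG e heW p hp q hq hqp.symm hep h x hx)
    rcases lt_or_gt_of_ne h0 with h | h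
    · exact ⟨-e, W.neg_mem heW, by simp [hep], by simpa using h⟩
    · exact ⟨e, heW, hep, h⟩
  have hneg : (P.filter fun s => e s < 0).Nonempty := by
    by_contra hcon
    rw [Finset.not_nonempty_iff_eq_empty, Finset.filter_eq_empty_iff] at hcon
    have := (Finset.sum_eq_zero_iff_of_nonneg fun r hr => not_lt.1 (hcon hr)).1 (hsum e heW) q hq
    linarith
  obtain ⟨r, hr, hmin⟩ := Finset.exists_min_image _ (fun s => c s / -(e s)) hneg
  rw [Finset.mem_filter] at hr
  obtain ⟨hrP, her⟩ := hr
  have hrp : r ≠ p := by rintro rfl; linarith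
  have hrq : r ≠ q := by rintro rfl; linarith
  have hcr : 0 < c r := hc.pos hG hcW hp hq hcq hrP hrp hrq
  have htpos : 0 < c r / -(e r) := div_pos hcr (by linarith)
  set t := c r / -(e r) with ht
  have hte : c r + t * e r = 0 := by
    rw [ht]; have := her.ne; field_simp; ring
  have hbd : ∀ s ∈ P, e s < 0 → t * -(e s) ≤ c s := by
    intro s hs hes
    have := hmin s (Finset.mem_filter.2 ⟨hs, hes⟩)
    rwa [le_div_iff₀ (by linarith)] at this
  have hrep : IsRepresentation P p (c + t • e) := by
    refine ⟨by simp [hep, hc.1], fun s hs hsp => ?_⟩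
    simp only [Pi.add_apply, Pi.smul_apply, smul_eq_mul]
    by_cases hes : e s < 0
    · linarith [hbd s hs hes]
    · have := mul_nonneg htpos.le (not_lt.1 hes)
      linarith [hc.2 s hs hsp]
  have hW' : c + t • e ∈ W := W.add_mem hcW (W.smul_mem _ heW)
  have hset : omissible W P p = {q, r} := by
    ext s
    simp only [Finset.mem_insert, Finset.mem_singleton]
    constructor
    · intro hs
      obtain ⟨hsP, hsp, c', hcW', hc', hcs'⟩ := mem_omissible.1 hs
      by_contra! hsn
      set u := c' q / e q with hu
      have hval : ∀ x ∈ P, c' x = c x + u * e x := by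
        intro x hx
        have := hG (c' - c - u • e) (W.sub_mem (W.sub_mem hcW' hcW) (W.smul_mem _ heW))
          p hp q hq hqp.symm (by simp [hc.1, hc'.1, hep])
          (by simp [hcq, hu, heq.ne']) x hx
        simp only [Pi.sub_apply, Pi.smul_apply, smul_eq_mul] at this
        linarith
      have hu0 : 0 ≤ u := div_nonneg (hc'.2 q hq hqp) heq.le
      have hut : u ≤ t := by
        have h1 := hc'.2 r hrP hrp
        rw [hval r hrP] at h1
        by_contra! hlt
        nlinarith
      have hcs := hc.pos hG hcW hp hq hcq hsP hsp hsn.1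
      have hts : 0 < (c + t • e) s :=
        hrep.pos hG hW' hp hrP (by simpa using hte) hsP hsp hsn.2
      simp only [Pi.add_apply, Pi.smul_apply, smul_eq_mul] at hts
      rw [hval s hsP] at hcs'
      rcases le_or_gt 0 (e s) with h | h
      · nlinarith [mul_nonneg hu0 h]
      · nlinarith
    · rintro (rfl | rfl)
      · exact hmem
      · exact mem_omissible.2 ⟨hrP, hrp, _, hW', hrep, by simpa using hte⟩
  rw [hset, Finset.card_pair hrq.symm]

lemma card_biUnion_omissible (hP : 4 ≤ P.card)
    (hsum : ∀ c ∈ W, ∑ x ∈ P, c x = 0)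
    (hG : ∀ c ∈ W, ∀ a ∈ P, ∀ b ∈ P, a ≠ b → c a = 0 → c b = 0 → ∀ x ∈ P, c x = 0)
    (hex : ∀ p ∈ P, ∃ e ∈ W, e p = 0 ∧ ∃ x ∈ P, e x ≠ 0) :
    (P.biUnion (omissible W P)).card ∈ ({0, 2, 4} : Set ℕ) := by
  have hdisj : (P : Set α).PairwiseDisjoint (omissible W P) := by
    intro p hp p' hp' hne
    refine Finset.disjoint_left.2 fun q hq hq' => hne ?_
    exact eq_of_mem_omissible hP hG hp hp' hq hq'
  set S := P.filter fun p => (omissible W P p).Nonempty with hS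
  have hcard : (P.biUnion (omissible W P)).card = 2 * S.card := by
    rw [Finset.card_biUnion hdisj, hS, Finset.card_filter, Finset.mul_sum]
    refine Finset.sum_congr rfl fun p hp => ?_
    split_ifs with h
    · obtain ⟨q, hq⟩ := h
      rw [card_omissible_of_mem hsum hG hex hp hq, mul_one]
    · rw [Finset.not_nonempty_iff_eq_empty.1 h, Finset.card_empty, mul_zero]
  have hS2 : S.card ≤ 2 := by
    by_contra! hlt
    obtain ⟨p₁, h₁, p₂, h₂, p₃, h₃, h₁₂, h₁₃, h₂₃⟩ := Finset.two_lt_card.1 hlt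
    rw [hS, Finset.mem_filter] at h₁ h₂ h₃
    obtain ⟨hp₁, q₁, hq₁⟩ := h₁
    obtain ⟨hp₂, q₂, hq₂⟩ := h₂
    obtain ⟨hp₃, q₃, hq₃⟩ := h₃
    obtain ⟨-, -, c₁, hW₁, hc₁, -⟩ := mem_omissible.1 hq₁
    obtain ⟨-, -, c₂, hW₂, hc₂, -⟩ := mem_omissible.1 hq₂
    obtain ⟨-, -, c₃, hW₃, hc₃, -⟩ := mem_omissible.1 hq₃
    exact h₂₃ <| eq_of_mem_omissible hP hG hp₂ hp₃
      (mem_omissible_of_isRepresentation hP hsum hG hp₁ hp₂ h₁₂ hW₁ hW₂ hc₁ hc₂)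
      (mem_omissible_of_isRepresentation hP hsum hG hp₁ hp₃ h₁₃ hW₁ hW₃ hc₁ hc₃)
  rw [hcard]
  interval_cases S.card <;> simp

end Combinatorics

section Geometry

variable {E : Type*} [AddCommGroup E] [Module ℝ E] {P : Finset E}

lemma eq_zero_of_mem_affineDependencies {c : E → ℝ} {A : Finset E}
    (hc : c ∈ affineDependencies P) (hAP : A ⊆ P) (h0 : ∀ x ∈ P, x ∉ A → c x = 0)
    (hA : AffineIndependent ℝ (fun p : {x // x ∈ A} => (p : E))) : ∀ x ∈ P, c x = 0 := by
  obtain ⟨h1, h2⟩ := hc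
  rw [← Finset.sum_subset hAP h0] at h1
  rw [← Finset.sum_subset hAP fun x hx hxA => by rw [h0 x hx hxA, zero_smul]] at h2
  intro x hx
  by_cases hxA : x ∈ A
  · rw [affineIndependent_iff] at hA
    have h1' : ∑ y ∈ A.attach, c y = 0 := by rwa [Finset.sum_attach A c]
    have h2' : ∑ y ∈ A.attach, c y • (y : E) = 0 := by
      rwa [Finset.sum_attach A fun y => c y • y]
    exact hA A.attach (fun y => c y) h1' h2' ⟨x, hxA⟩ (Finset.mem_attach _ _)
  · exact h0 x hx hxA

lemma mem_convexHull_erase_iff {p q : E} (hp : p ∈ P) (hq : q ∈ P) (hqp : q ≠ p) :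
    p ∈ convexHull ℝ (((P.erase q).erase p : Finset E) : Set E) ↔
      q ∈ omissible (affineDependencies P) P p := by
  rw [Finset.mem_convexHull', mem_omissible]
  have hp' : p ∈ P.erase q := Finset.mem_erase.2 ⟨hqp.symm, hp⟩
  constructor
  · rintro ⟨w, hw0, hw1, hw⟩
    have hcong : ∀ x ∈ (P.erase q).erase p,
        (if x = p then -1 else if x = q then 0 else w x) = w x := by
      intro x hx
      simp only [Finset.mem_erase] at hx
      rw [if_neg hx.1, if_neg hx.2.1]
    refine ⟨hq, hqp, fun x => if x = p then -1 else if x = q then 0 else w x, ⟨?_, ?_⟩,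
      ⟨by simp, ?_⟩, by simp [hqp]⟩
    · rw [← Finset.add_sum_erase _ _ hq, ← Finset.add_sum_erase _ _ hp',
        Finset.sum_congr rfl hcong, hw1]
      simp [hqp]
    · rw [← Finset.add_sum_erase _ _ hq, ← Finset.add_sum_erase _ _ hp',
        Finset.sum_congr rfl fun x hx => congrArg (· • x) (hcong x hx), hw]
      simp [hqp]
    · intro r hr hrp
      simp only [if_neg hrp]
      split_ifs with h
      · exact le_rfl
      · exact hw0 r (by simp [h, hrp, hr])
  · rintro ⟨-, -, c, ⟨h1, h2⟩, hc, hcq⟩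
    rw [← Finset.add_sum_erase _ _ hq, ← Finset.add_sum_erase _ _ hp', hcq, hc.1] at h1 h2
    refine ⟨c, fun y hy => ?_, by linarith, ?_⟩
    · simp only [Finset.mem_erase] at hy
      exact hc.2 y hy.2.2 hy.1
    · rw [zero_smul, zero_add, neg_one_smul] at h2
      exact (neg_add_eq_zero.1 h2).symm

lemma exists_mem_affineDependencies_ne_zero [FiniteDimensional ℝ E] {p : E} (hp : p ∈ P)
    (hcard : Module.finrank ℝ E + 2 < P.card) :
    ∃ e ∈ affineDependencies P, e p = 0 ∧ ∃ x ∈ P, e x ≠ 0 := by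
  obtain ⟨f, hf, hf', x, hx, hfx⟩ :=
    Module.exists_nontrivial_relation_sum_zero_of_finrank_succ_lt_card (R := ℝ) (t := P.erase p)
      (by rw [Finset.card_erase_of_mem hp]; omega)
  have hcong : ∀ x ∈ P.erase p, (if x = p then 0 else f x) = f x := fun x hx =>
    if_neg (Finset.ne_of_mem_erase hx)
  refine ⟨fun x => if x = p then 0 else f x, ⟨?_, ?_⟩, by simp, x, Finset.mem_of_mem_erase hx, ?_⟩
  · rw [← Finset.add_sum_erase _ _ hp, Finset.sum_congr rfl hcong, hf']
    simp
  · rw [← Finset.add_sum_erase _ _ hp,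
      Finset.sum_congr rfl fun x hx => congrArg (· • x) (hcong x hx), hf]
    simp
  · simpa only [hcong x hx] using hfx

lemma filter_not_convexPosition_eq_image {n : ℕ} (hP : P.card = n + 1) :
    (P.powersetCard n).filter
      (fun Q => ¬ (∀ q ∈ Q, q ∉ convexHull ℝ ((Q.erase q : Finset _) : Set E))) =
    (P.biUnion (omissible (affineDependencies P) P)).image P.erase := by
  ext Q
  simp only [Finset.mem_filter, Finset.mem_powersetCard, Finset.mem_image, Finset.mem_biUnion]
  push Not
  constructor
  · rintro ⟨⟨hQP, hQ⟩, p, hpQ, hp⟩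
    obtain ⟨q, hq⟩ : ∃ q, P \ Q = {q} := by
      rw [← Finset.card_eq_one, Finset.card_sdiff_of_subset hQP]
      omega
    have hqP : q ∈ P \ Q := hq ▸ Finset.mem_singleton_self q
    rw [Finset.mem_sdiff] at hqP
    obtain rfl : P.erase q = Q := by
      rw [← Finset.sdiff_singleton_eq_erase, ← hq, Finset.sdiff_sdiff_eq_self hQP]
    obtain ⟨hpq, hpP⟩ := Finset.mem_erase.1 hpQ
    exact ⟨q, ⟨p, hpP, (mem_convexHull_erase_iff hpP hqP.1 hpq.symm).1 hp⟩, rfl⟩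
  · rintro ⟨q, ⟨p, hp, hq⟩, rfl⟩
    obtain ⟨hqP, hqp, -⟩ := mem_omissible.1 hq
    refine ⟨⟨Finset.erase_subset _ _, by rw [Finset.card_erase_of_mem hqP]; omega⟩, p,
      Finset.mem_erase.2 ⟨hqp.symm, hp⟩, (mem_convexHull_erase_iff hp hqP hqp).2 hq⟩

lemma card_filter_not_convexPosition_mem [FiniteDimensional ℝ E] {d : ℕ} (hd : 1 ≤ d)
    (hE : Module.finrank ℝ E = d) (hP : P.card = d + 3)
    (hgp : ∀ A : Finset E, A ⊆ P → A.card = d + 1 →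
      AffineIndependent ℝ (fun p : {x // x ∈ A} => (p : E))) :
    ((P.powersetCard (d + 2)).filter
      (fun Q => ¬ (∀ q ∈ Q, q ∉ convexHull ℝ ((Q.erase q : Finset _) : Set E)))).card ∈
      ({0, 2, 4} : Set ℕ) := by
  rw [filter_not_convexPosition_eq_image hP, Finset.card_image_of_injOn]
  · refine card_biUnion_omissible (by omega) (fun c hc => hc.1) ?_ ?_
    · intro c hc a ha b hb hab hca hcb
      have hA : ((P.erase a).erase b).card = d + 1 := by
        rw [Finset.card_erase_of_mem (Finset.mem_erase.2 ⟨hab.symm, hb⟩),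
          Finset.card_erase_of_mem ha]
        omega
      have hsub : (P.erase a).erase b ⊆ P :=
        (Finset.erase_subset _ _).trans (Finset.erase_subset _ _)
      refine eq_zero_of_mem_affineDependencies hc hsub (fun x hx hxA => ?_) (hgp _ hsub hA)
      by_cases hxb : x = b
      · rwa [hxb]
      · by_cases hxa : x = a
        · rwa [hxa]
        · exact absurd (by simp [hxa, hxb, hx]) hxA
    · intro p hp
      exact exists_mem_affineDependencies_ne_zero hp (by omega)
  · refine (Finset.erase_injOn P).mono fun q hq => ?_
    obtain ⟨p, -, hq⟩ := Finset.mem_biUnion.1 hq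
    exact (mem_omissible.1 hq).1

end Geometry

/-- **Motzkin's observation.** Let `d ≥ 2` and let `P` be a set of `d + 3`
points of `ℝ^d` in general position (every `d + 1` of them are affinely independent).
Then the number of `(d+2)`-element subsets of `P` that are not in convex position is
exactly 0, 2, or 4. A finite set `Q` is in convex position when no point of `Q` lies in
the convex hull of the remaining points of `Q`. -/
theorem motzkin_024 (d : ℕ) (hd : 2 ≤ d)
    (P : Finset (EuclideanSpace ℝ (Fin d))) (hP : P.card = d + 3)
    (hgp : ∀ A : Finset (EuclideanSpace ℝ (Fin d)), A ⊆ P → A.card = d + 1 →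
      AffineIndependent ℝ (fun p : {x // x ∈ A} => (p : EuclideanSpace ℝ (Fin d)))) :
    ((P.powersetCard (d + 2)).filter
        (fun Q => ¬ (∀ q ∈ Q, q ∉ convexHull ℝ ((Q.erase q : Finset _) :
          Set (EuclideanSpace ℝ (Fin d)))))).card ∈ ({0, 2, 4} : Set ℕ) := by
  convert card_filter_not_convexPosition_mem (by omega) finrank_euclideanSpace_fin hP hgp
end

section
/- For every integer k ≥ 4 there exists a constant c' > 0 (depending only on k) such that for every integer n ≥ k there exists a family F of k-element subsets of [n] = {1, …, n} with |F| ≥ c'·n^(k−3) such that every (k−3)-element subset of [n] is contained in at most one member of F (equivalently, any two distinct members of F intersect in at most k−4 elements). -/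
open Polynomial in
/-- The graph over `ι` (placed in `K` by `v`) of a polynomial. -/
noncomputable def evalGraph {ι K : Type*} [Fintype ι] [Field K] (v : ι → K) (f : K[X]) :
    Finset (ι × K) :=
  Finset.univ.map ⟨fun i => (i, f.eval (v i)), fun _ _ h => congrArg Prod.fst h⟩

open Polynomial in
theorem mem_evalGraph {ι K : Type*} [Fintype ι] [Field K] {v : ι → K} {f : K[X]} {x : ι × K} :
    x ∈ evalGraph v f ↔ f.eval (v x.1) = x.2 := by
  obtain ⟨i, a⟩ := x
  simp only [evalGraph, Finset.mem_map, Finset.mem_univ, true_and]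
  change (∃ j, (j, f.eval (v j)) = (i, a)) ↔ _
  simp

open Polynomial in
theorem card_evalGraph {ι K : Type*} [Fintype ι] [Field K] (v : ι → K) (f : K[X]) :
    (evalGraph v f).card = Fintype.card ι := by
  simp [evalGraph]

open Polynomial in
/-- A polynomial of degree less than `d` is determined by `d` points of its graph. -/
theorem eq_of_subset_evalGraph {ι K : Type*} [Fintype ι] [Field K] {v : ι → K}
    (hv : Function.Injective v) {f g : K[X]} {T : Finset (ι × K)}
    (hf : f.degree < T.card) (hg : g.degree < T.card)
    (hfT : T ⊆ evalGraph v f) (hgT : T ⊆ evalGraph v g) : f = g := by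
  have key : ∀ x ∈ T, f.eval (v x.1) = x.2 ∧ g.eval (v x.1) = x.2 := fun x hx =>
    ⟨mem_evalGraph.1 (hfT hx), mem_evalGraph.1 (hgT hx)⟩
  refine eq_of_degrees_lt_of_eval_index_eq (v := fun x : ι × K => v x.1) T ?_ hf hg
    fun x hx => (key x hx).1.trans (key x hx).2.symm
  intro x hx y hy hxy
  have h : x.1 = y.1 := hv hxy
  exact Prod.ext h (by rw [← (key x hx).1, ← (key y hy).1, h])

open Polynomial in
/-- The graphs of the polynomials of degree less than `d` form a family of `Fintype.card K ^ d`
sets, no two of which share `d` points. -/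
theorem exists_evalGraph_family {ι K : Type*} [Fintype ι] [Field K] [Fintype K]
    (v : ι → K) (hv : Function.Injective v) (d : ℕ) (hd : d ≤ Fintype.card ι) :
    ∃ F : Finset (Finset (ι × K)),
      (∀ A ∈ F, A.card = Fintype.card ι) ∧ F.card = Fintype.card K ^ d ∧
      ∀ T : Finset (ι × K), T.card = d → ∀ A ∈ F, ∀ B ∈ F, T ⊆ A → T ⊆ B → A = B := by
  classical
  let P : (Fin d → K) → K[X] := fun c => ((degreeLTEquiv K d).symm c : K[X])
  have hP : ∀ c, (P c).degree < d := fun c => mem_degreeLT.1 (Subtype.prop _)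
  have inj : Function.Injective fun c => evalGraph v (P c) := by
    intro a b hab
    obtain ⟨T, hT, hTd⟩ := Finset.exists_subset_card_eq
      (hd.trans_eq (card_evalGraph v (P a)).symm)
    have h : P a = P b := eq_of_subset_evalGraph hv (hTd ▸ hP a) (hTd ▸ hP b) hT
      (hT.trans (Finset.subset_of_eq hab))
    exact (degreeLTEquiv K d).symm.injective (Subtype.ext h)
  refine ⟨Finset.univ.map ⟨_, inj⟩, ?_, by simp, ?_⟩
  · intro A hA
    obtain ⟨c, -, rfl⟩ := Finset.mem_map.1 hA
    exact card_evalGraph v _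
  · intro T hT A hA B hB hTA hTB
    obtain ⟨a, -, rfl⟩ := Finset.mem_map.1 hA
    obtain ⟨b, -, rfl⟩ := Finset.mem_map.1 hB
    exact congrArg (evalGraph v)
      (eq_of_subset_evalGraph hv (hT ▸ hP a) (hT ▸ hP b) hTA hTB)

/-- If `p ≥ k` is prime and `k * p ≤ n`, there are `p ^ d` subsets of `[n]` of size `k`, no two of
which share `d` points. -/
theorem exists_family_of_prime {k p n d : ℕ} (hp : p.Prime) (hkp : k ≤ p) (hn : k * p ≤ n)
    (hd : d ≤ k) :
    ∃ F : Finset (Finset (Fin n)),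
      (∀ A ∈ F, A.card = k) ∧ F.card = p ^ d ∧
      ∀ T : Finset (Fin n), T.card = d → (F.filter (fun A => T ⊆ A)).card ≤ 1 := by
  classical
  have : Fact p.Prime := ⟨hp⟩
  obtain ⟨v⟩ := Function.Embedding.nonempty_of_card_le (α := Fin k) (β := ZMod p)
    (by simpa [ZMod.card] using hkp)
  obtain ⟨e⟩ := Function.Embedding.nonempty_of_card_le (α := Fin k × ZMod p) (β := Fin n)
    (by simpa [ZMod.card] using hn)
  obtain ⟨F, hcard, hF, huniq⟩ :=
    exists_evalGraph_family v v.injective d (by simpa using hd)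
  refine ⟨F.map (Finset.mapEmbedding e).toEmbedding, ?_, by simp [hF, ZMod.card], ?_⟩
  · intro A hA
    obtain ⟨B, hB, rfl⟩ := Finset.mem_map.1 hA
    simpa using hcard B hB
  · intro T hT
    rw [Finset.card_le_one]
    intro A hAT B hBT
    obtain ⟨hA, hTA⟩ := Finset.mem_filter.1 hAT
    obtain ⟨hB, hTB⟩ := Finset.mem_filter.1 hBT
    obtain ⟨A, hAF, rfl⟩ := Finset.mem_map.1 hA
    obtain ⟨B, hBF, rfl⟩ := Finset.mem_map.1 hB
    obtain ⟨S, hS, rfl⟩ := Finset.subset_map_iff.1 hTA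
    rw [huniq S (by simpa using hT) A hAF B hBF hS (Finset.map_subset_map.1 hTB)]

/-- For every integer `k ≥ 4` there exists `c' > 0` such that for every
`n ≥ k` there is a partial Steiner `(n, k, k-3)` system of size at least `c' * n ^ (k-3)`:
a family `F` of `k`-element subsets of `[n]` with `|F| ≥ c' * n ^ (k-3)` such that every
`(k-3)`-element subset of `[n]` is contained in at most one member of `F`. -/
theorem partial_steiner_system (k : ℕ) (hk : 4 ≤ k) :
    ∃ c' : ℝ, 0 < c' ∧ ∀ n : ℕ, k ≤ n →
      ∃ F : Finset (Finset (Fin n)),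
        (∀ A ∈ F, A.card = k) ∧
        (c' * (n : ℝ) ^ (k - 3) ≤ (F.card : ℝ)) ∧
        (∀ T : Finset (Fin n), T.card = k - 3 → (F.filter (fun A => T ⊆ A)).card ≤ 1) := by
  have hk0 : 0 < k := by lia
  refine ⟨((2 * k ^ 2 : ℝ) ^ (k - 3))⁻¹, by positivity, fun n hn => ?_⟩
  have bound : ∀ q : ℕ, n ≤ 2 * k ^ 2 * q →
      ((2 * k ^ 2 : ℝ) ^ (k - 3))⁻¹ * (n : ℝ) ^ (k - 3) ≤ ((q ^ (k - 3) : ℕ) : ℝ) := by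
    intro q hq
    rw [inv_mul_le_iff₀ (by positivity)]
    exact_mod_cast (Nat.pow_le_pow_left hq (k - 3)).trans_eq (mul_pow _ _ _)
  rcases le_total n (2 * k ^ 2) with hsmall | hlarge
  · obtain ⟨A, -, hA⟩ := Finset.exists_subset_card_eq
      (s := (Finset.univ : Finset (Fin n))) (by simpa using hn)
    refine ⟨{A}, by simpa using hA, ?_, fun T _ => ?_⟩
    · simpa using bound 1 (by simpa using hsmall)
    · exact (Finset.card_filter_le _ _).trans_eq (Finset.card_singleton A)
  · set t := n / (2 * k) with ht
    have hkt : k ≤ t := (Nat.le_div_iff_mul_le (by positivity)).2 (by linarith)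
    have htn : t * (2 * k) ≤ n := Nat.div_mul_le_self _ _
    have hnt : n < 2 * k * (t + 1) := Nat.lt_mul_div_succ n (by positivity)
    obtain ⟨p, hp, htp, hpt⟩ := Nat.exists_prime_lt_and_le_two_mul t (by lia)
    obtain ⟨F, hcard, hF, huniq⟩ :=
      exists_family_of_prime (n := n) hp (hkt.trans htp.le) (by nlinarith) (Nat.sub_le k 3)
    refine ⟨F, hcard, ?_, huniq⟩
    rw [hF]
    refine bound p (hnt.le.trans (Nat.mul_le_mul ?_ htp))
    nlinarith
end
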